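/- arXiv:2108.03915 — 2 statements merged into one kernel-verified Lean document; each statement's English description precedes it below -/
import Mathlib

section
/- Let K be a field, let P₁, P₂ be finite posets on disjoint underlying sets, let {p} be a one-element poset, and let P be the ordinal sum P₁ ⊕ {p} ⊕ P₂. Then the Hibi ring R[I(P)] is isomorphic as a K-algebra to the tensor product R[I(P₁)] ⊗_K R[I(P₂)]. -/
open MvPolynomial

/-- The Hibi monomial `u_α = t · ∏_{p ∈ α} z_p`, as an element of the
polynomial ring `K[t, z_p : p ∈ P]` (the variable `none` is `t`). -/
noncomputable def hibiMonomial (K : Type*) [CommRing K] {P : Type*} [Finite P]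
    (α : Set P) : MvPolynomial (Option P) K :=
  X none * ∏ p ∈ (Set.toFinite α).toFinset, X (some p)

/-- The Hibi ring `R[I(P)]`: the `K`-subalgebra of `K[t, z_p : p ∈ P]`
generated by the monomials `u_α`, for `α` an order ideal (lower set) of `P`. -/
noncomputable def hibiRing (K : Type*) [Field K] (P : Type*) [Finite P] [PartialOrder P] :
    Subalgebra K (MvPolynomial (Option P) K) :=
  Algebra.adjoin K { f | ∃ α : Set P, IsLowerSet α ∧ f = hibiMonomial K α }

instance {α β : Type*} [Finite α] [Finite β] : Finite (α ⊕ₗ β) :=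
  inferInstanceAs (Finite (α ⊕ β))

/-- The `K`-algebra map `K[t, z_p : p ∈ P] → K[t, z_q : q ∈ Q]` sending `t` to `u_γ` and
`z_p` to `z_{i p}`. -/
noncomputable def hibiShift (K : Type*) [CommRing K] {P Q : Type*} [Finite Q]
    (γ : Set Q) (i : P → Q) : MvPolynomial (Option P) K →ₐ[K] MvPolynomial (Option Q) K :=
  aeval fun o => o.elim (hibiMonomial K γ) fun p => X (some (i p))

theorem hibiMonomial_eq_finprod (K : Type*) [CommRing K] {P : Type*} [Finite P] (α : Set P) :
    hibiMonomial K α = X none * ∏ᶠ p ∈ α, X (some p) := by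
  rw [hibiMonomial, finprod_mem_eq_finite_toFinset_prod _ (Set.toFinite α)]

theorem hibiMonomial_empty (K : Type*) [CommRing K] {P : Type*} [Finite P] :
    hibiMonomial K (∅ : Set P) = X none := by
  simp [hibiMonomial]

theorem hibiMonomial_insert (K : Type*) [CommRing K] {P : Type*} [Finite P] {p : P} {α : Set P}
    (hp : p ∉ α) : hibiMonomial K (insert p α) = X (some p) * hibiMonomial K α := by
  rw [hibiMonomial_eq_finprod, hibiMonomial_eq_finprod,
    finprod_mem_insert _ hp (Set.toFinite α), mul_left_comm]

theorem hibiMonomial_ne_zero (K : Type*) [Field K] {P : Type*} [Finite P] (α : Set P) :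
    hibiMonomial K α ≠ 0 :=
  mul_ne_zero (X_ne_zero _) (Finset.prod_ne_zero_iff.2 fun _ _ => X_ne_zero _)

theorem hibiShift_hibiMonomial (K : Type*) [CommRing K] {P Q : Type*} [Finite P] [Finite Q]
    {γ : Set Q} {i : P → Q} (hi : Function.Injective i) (hγ : Disjoint γ (Set.range i))
    (α : Set P) : hibiShift K γ i (hibiMonomial K α) = hibiMonomial K (γ ∪ i '' α) := by
  have h : hibiShift K γ i (hibiMonomial K α) =
      hibiMonomial K γ * ∏ᶠ p ∈ α, X (some (i p)) := by
    rw [finprod_mem_eq_finite_toFinset_prod _ (Set.toFinite α)]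
    simp [hibiShift, hibiMonomial]
  rw [h, hibiMonomial_eq_finprod, hibiMonomial_eq_finprod,
    finprod_mem_union (hγ.mono_right (Set.image_subset_range i α)) (Set.toFinite _)
      (Set.toFinite _), finprod_mem_image hi.injOn, mul_assoc]

theorem map_hibiShift_hibiRing (K : Type*) [Field K] {P Q : Type*} [Finite P] [PartialOrder P]
    [Finite Q] {γ : Set Q} {i : P → Q} (hi : Function.Injective i)
    (hγ : Disjoint γ (Set.range i)) :
    (hibiRing K P).map (hibiShift K γ i) =
      Algebra.adjoin K {f | ∃ α : Set P, IsLowerSet α ∧ f = hibiMonomial K (γ ∪ i '' α)} := by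
  rw [hibiRing, AlgHom.map_adjoin]
  congr 1
  ext f
  constructor
  · rintro ⟨_, ⟨α, hα, rfl⟩, rfl⟩
    exact ⟨α, hα, hibiShift_hibiMonomial K hi hγ α⟩
  · rintro ⟨α, hα, rfl⟩
    exact ⟨_, ⟨α, hα, rfl⟩, hibiShift_hibiMonomial K hi hγ α⟩

namespace OrdinalSum

variable {P₁ P₂ : Type*}

/-- The inclusion of the bottom summand in `P₁ ⊕ {p} ⊕ P₂`. -/
def bottom (x : P₁) : P₁ ⊕ₗ (PUnit ⊕ₗ P₂) := toLex (Sum.inl x)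

/-- The middle point of `P₁ ⊕ {p} ⊕ P₂`. -/
def middle : P₁ ⊕ₗ (PUnit ⊕ₗ P₂) := toLex (Sum.inr (toLex (Sum.inl PUnit.unit)))

/-- The inclusion of the top summand in `P₁ ⊕ {p} ⊕ P₂`. -/
def top (y : P₂) : P₁ ⊕ₗ (PUnit ⊕ₗ P₂) := toLex (Sum.inr (toLex (Sum.inr y)))

theorem cases (q : P₁ ⊕ₗ (PUnit ⊕ₗ P₂)) :
    (∃ x, q = bottom x) ∨ q = middle ∨ ∃ y, q = top y := by
  rcases q with x | ⟨⟨⟩⟩ | y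
  exacts [.inl ⟨x, rfl⟩, .inr (.inl rfl), .inr (.inr ⟨y, rfl⟩)]

theorem bottom_injective : Function.Injective (bottom : P₁ → P₁ ⊕ₗ (PUnit ⊕ₗ P₂)) :=
  fun _ _ h => Sum.inl_injective h

theorem top_injective : Function.Injective (top : P₂ → P₁ ⊕ₗ (PUnit ⊕ₗ P₂)) :=
  fun _ _ h => Sum.inr_injective (Sum.inr_injective h)

theorem bottom_ne_middle (x : P₁) : (bottom x : P₁ ⊕ₗ (PUnit ⊕ₗ P₂)) ≠ middle :=
  Sum.inl_ne_inr

theorem bottom_ne_top (x : P₁) (y : P₂) : (bottom x : P₁ ⊕ₗ (PUnit ⊕ₗ P₂)) ≠ top y :=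
  Sum.inl_ne_inr

theorem middle_ne_top (y : P₂) : (middle : P₁ ⊕ₗ (PUnit ⊕ₗ P₂)) ≠ top y :=
  fun h => Sum.inl_ne_inr (Sum.inr_injective h)

theorem middle_notMem_range_bottom :
    (middle : P₁ ⊕ₗ (PUnit ⊕ₗ P₂)) ∉ Set.range bottom := by
  rintro ⟨x, hx⟩
  exact bottom_ne_middle x hx

theorem disjoint_insert_middle_range_top :
    Disjoint (insert middle (Set.range bottom) : Set (P₁ ⊕ₗ (PUnit ⊕ₗ P₂))) (Set.range top) := by
  rw [Set.disjoint_left]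
  rintro _ (rfl | ⟨x, rfl⟩) ⟨y, hy⟩
  exacts [middle_ne_top y hy.symm, bottom_ne_top x y hy.symm]

section Order

variable [PartialOrder P₁] [PartialOrder P₂]

theorem bottom_le_bottom {x x' : P₁} :
    (bottom x : P₁ ⊕ₗ (PUnit ⊕ₗ P₂)) ≤ bottom x' ↔ x ≤ x' :=
  Sum.Lex.inl_le_inl_iff

theorem bottom_le_middle (x : P₁) : (bottom x : P₁ ⊕ₗ (PUnit ⊕ₗ P₂)) ≤ middle :=
  Sum.Lex.inl_le_inr _ _

theorem middle_le_top (y : P₂) : (middle : P₁ ⊕ₗ (PUnit ⊕ₗ P₂)) ≤ top y :=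
  Sum.Lex.inr_le_inr_iff.2 (Sum.Lex.inl_le_inr _ _)

theorem not_middle_le_bottom (x : P₁) : ¬ (middle : P₁ ⊕ₗ (PUnit ⊕ₗ P₂)) ≤ bottom x :=
  Sum.Lex.not_inr_le_inl

theorem not_top_le_bottom (x : P₁) (y : P₂) :
    ¬ (top y : P₁ ⊕ₗ (PUnit ⊕ₗ P₂)) ≤ bottom x :=
  Sum.Lex.not_inr_le_inl

theorem not_top_le_middle (y : P₂) : ¬ (top y : P₁ ⊕ₗ (PUnit ⊕ₗ P₂)) ≤ middle :=
  fun h => Sum.Lex.not_inr_le_inl (Sum.Lex.inr_le_inr_iff.1 h)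

theorem top_le_top {y y' : P₂} : (top y : P₁ ⊕ₗ (PUnit ⊕ₗ P₂)) ≤ top y' ↔ y ≤ y' :=
  Sum.Lex.inr_le_inr_iff.trans Sum.Lex.inr_le_inr_iff

/-- The order ideals of `P₁ ⊕ {p} ⊕ P₂` are those of `P₁` and the sets `P₁ ∪ {p} ∪ β` for `β` an
order ideal of `P₂`. -/
theorem isLowerSet_iff (γ : Set (P₁ ⊕ₗ (PUnit ⊕ₗ P₂))) :
    IsLowerSet γ ↔ (∃ α : Set P₁, IsLowerSet α ∧ γ = ∅ ∪ bottom '' α) ∨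
      ∃ β : Set P₂, IsLowerSet β ∧ γ = insert middle (Set.range bottom) ∪ top '' β := by
  constructor
  · intro h
    by_cases hm : middle ∈ γ
    · refine .inr ⟨top ⁻¹' γ, fun y y' hy hmem => h (top_le_top.2 hy) hmem, ?_⟩
      ext q
      rcases cases q with ⟨x, rfl⟩ | rfl | ⟨y, rfl⟩
      · simp [h (bottom_le_middle x) hm]
      · simp [hm]
      · simp [top_injective.eq_iff, (middle_ne_top y).symm, bottom_ne_top]
    · refine .inl ⟨bottom ⁻¹' γ, fun x x' hx hmem => h (bottom_le_bottom.2 hx) hmem, ?_⟩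
      ext q
      rcases cases q with ⟨x, rfl⟩ | rfl | ⟨y, rfl⟩
      · simp [bottom_injective.eq_iff]
      · simp [hm, bottom_ne_middle]
      · simpa [bottom_ne_top] using fun hy => hm (h (middle_le_top y) hy)
  · rintro (⟨α, hα, rfl⟩ | ⟨β, hβ, rfl⟩)
    · rw [Set.empty_union]
      rintro _ q hq ⟨x, hx, rfl⟩
      rcases cases q with ⟨x', rfl⟩ | rfl | ⟨y, rfl⟩
      · exact ⟨x', hα (bottom_le_bottom.1 hq) hx, rfl⟩
      · exact (not_middle_le_bottom _ hq).elim
      · exact (not_top_le_bottom _ _ hq).elim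
    · intro r q hq hr
      rcases cases q with ⟨x', rfl⟩ | rfl | ⟨y, rfl⟩
      · exact .inl (.inr ⟨x', rfl⟩)
      · exact .inl (.inl rfl)
      · rcases hr with (rfl | ⟨x, rfl⟩) | ⟨y', hy', rfl⟩
        · exact (not_top_le_middle _ hq).elim
        · exact (not_top_le_bottom _ _ hq).elim
        · exact .inr ⟨y, hβ (top_le_top.1 hq) hy', rfl⟩

end Order

variable (P₁ P₂) (K : Type*) [Field K]

/-- The inclusion of `K[t₁, z_x, t₂, z_y : x ∈ P₁, y ∈ P₂]` in its fraction field. -/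
noncomputable def toFractionRing : MvPolynomial (Option P₁ ⊕ Option P₂) K →ₐ[K]
    FractionRing (MvPolynomial (Option P₁ ⊕ Option P₂) K) :=
  IsScalarTower.toAlgHom K _ _

theorem toFractionRing_injective : Function.Injective (toFractionRing P₁ P₂ K) :=
  FaithfulSMul.algebraMap_injective (MvPolynomial (Option P₁ ⊕ Option P₂) K)
    (FractionRing (MvPolynomial (Option P₁ ⊕ Option P₂) K))

variable [Finite P₁] [Finite P₂]

/-- The map `K[t, z_x : x ∈ P₁] → K[t, z_q : q ∈ P₁ ⊕ {p} ⊕ P₂]` sending `u_α` to `u_α`. -/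
noncomputable def bottomShift :
    MvPolynomial (Option P₁) K →ₐ[K] MvPolynomial (Option (P₁ ⊕ₗ (PUnit ⊕ₗ P₂))) K :=
  hibiShift K ∅ bottom

/-- The map `K[t, z_y : y ∈ P₂] → K[t, z_q : q ∈ P₁ ⊕ {p} ⊕ P₂]` sending `u_β` to
`u_{P₁ ∪ {p} ∪ β}`. -/
noncomputable def topShift :
    MvPolynomial (Option P₂) K →ₐ[K] MvPolynomial (Option (P₁ ⊕ₗ (PUnit ⊕ₗ P₂))) K :=
  hibiShift K (insert middle (Set.range bottom)) top

/-- A left inverse, with values in the fraction field, of the map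
`K[t, z_x : x ∈ P₁] ⊗ K[t, z_y : y ∈ P₂] → K[t, z_q : q ∈ P₁ ⊕ {p} ⊕ P₂]`. -/
noncomputable def unshift :
    MvPolynomial (Option (P₁ ⊕ₗ (PUnit ⊕ₗ P₂))) K →ₐ[K]
      FractionRing (MvPolynomial (Option P₁ ⊕ Option P₂) K) :=
  aeval fun o => o.elim (toFractionRing P₁ P₂ K (X (Sum.inl none))) fun q =>
    Sum.elim (fun x => toFractionRing P₁ P₂ K (X (Sum.inl (some x))))
      (fun r => Sum.elim
        (fun _ => toFractionRing P₁ P₂ K (X (Sum.inr none)) /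
          toFractionRing P₁ P₂ K (rename Sum.inl (hibiMonomial K (Set.univ : Set P₁))))
        (fun y => toFractionRing P₁ P₂ K (X (Sum.inr (some y)))) (ofLex r)) (ofLex q)

theorem unshift_bottomShift (f : MvPolynomial (Option P₁) K) :
    unshift P₁ P₂ K (bottomShift P₁ P₂ K f) = toFractionRing P₁ P₂ K (rename Sum.inl f) := by
  have h : (unshift P₁ P₂ K).comp (bottomShift P₁ P₂ K) =
      (toFractionRing P₁ P₂ K).comp
        (rename Sum.inl) := by
    ext (_ | x)
    · simp [unshift, bottomShift, hibiShift, hibiMonomial_empty]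
    · simp [unshift, bottomShift, hibiShift, bottom]
  exact DFunLike.congr_fun h f

theorem unshift_hibiMonomial :
    unshift P₁ P₂ K (hibiMonomial K (insert middle (Set.range bottom))) =
      toFractionRing P₁ P₂ K (X (Sum.inr none)) := by
  have h : hibiMonomial K (Set.range (bottom : P₁ → P₁ ⊕ₗ (PUnit ⊕ₗ P₂))) =
      bottomShift P₁ P₂ K (hibiMonomial K Set.univ) := by
    rw [bottomShift, hibiShift_hibiMonomial K bottom_injective (Set.empty_disjoint _),
      Set.image_univ, Set.empty_union]
  rw [hibiMonomial_insert K middle_notMem_range_bottom, map_mul, h, unshift_bottomShift]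
  have hne : toFractionRing P₁ P₂ K
      (rename Sum.inl (hibiMonomial K (Set.univ : Set P₁))) ≠ 0 := by
    rw [Ne, map_eq_zero_iff _ (toFractionRing_injective P₁ P₂ K),
      map_eq_zero_iff _ (rename_injective _ Sum.inl_injective)]
    exact hibiMonomial_ne_zero K _
  have hm : unshift P₁ P₂ K (X (some middle)) = toFractionRing P₁ P₂ K (X (Sum.inr none)) /
      toFractionRing P₁ P₂ K (rename Sum.inl (hibiMonomial K (Set.univ : Set P₁))) := by
    simp [unshift, middle]
  rw [hm, div_mul_cancel₀ _ hne]

theorem unshift_topShift (f : MvPolynomial (Option P₂) K) :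
    unshift P₁ P₂ K (topShift P₁ P₂ K f) = toFractionRing P₁ P₂ K (rename Sum.inr f) := by
  have h : (unshift P₁ P₂ K).comp (topShift P₁ P₂ K) =
      (toFractionRing P₁ P₂ K).comp
        (rename Sum.inr) := by
    ext (_ | y)
    · simp [topShift, hibiShift, unshift_hibiMonomial]
    · simp [unshift, topShift, hibiShift, top]
  exact DFunLike.congr_fun h f

theorem productMap_shift_injective :
    Function.Injective (Algebra.TensorProduct.productMap
      (bottomShift P₁ P₂ K) (topShift P₁ P₂ K)) := by
  have h : (unshift P₁ P₂ K).comp (Algebra.TensorProduct.productMap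
      (bottomShift P₁ P₂ K) (topShift P₁ P₂ K)) =
      (toFractionRing P₁ P₂ K).comp
        (tensorEquivSum K (Option P₁) (Option P₂) K).toAlgHom := by
    apply Algebra.TensorProduct.ext <;> ext o
    · simp [unshift_bottomShift]
    · simp [unshift_topShift]
  have hinj : Function.Injective ((unshift P₁ P₂ K).comp (Algebra.TensorProduct.productMap
      (bottomShift P₁ P₂ K) (topShift P₁ P₂ K))) := by
    rw [h]
    exact (toFractionRing_injective P₁ P₂ K).comp (AlgEquiv.injective _)
  rw [AlgHom.coe_comp] at hinj
  exact hinj.of_comp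

/-- The comparison map `R[I(P₁)] ⊗ R[I(P₂)] → K[t, z_q : q ∈ P₁ ⊕ {p} ⊕ P₂]`. -/
noncomputable def hibiTensorMap [PartialOrder P₁] [PartialOrder P₂] :
    TensorProduct K (hibiRing K P₁) (hibiRing K P₂) →ₐ[K]
      MvPolynomial (Option (P₁ ⊕ₗ (PUnit ⊕ₗ P₂))) K :=
  Algebra.TensorProduct.productMap ((bottomShift P₁ P₂ K).comp (hibiRing K P₁).val)
    ((topShift P₁ P₂ K).comp (hibiRing K P₂).val)

theorem hibiTensorMap_injective [PartialOrder P₁] [PartialOrder P₂] :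
    Function.Injective (hibiTensorMap P₁ P₂ K) := by
  have h : hibiTensorMap P₁ P₂ K = (Algebra.TensorProduct.productMap
      (bottomShift P₁ P₂ K) (topShift P₁ P₂ K)).comp
        (Algebra.TensorProduct.map (hibiRing K P₁).val (hibiRing K P₂).val) := by
    apply Algebra.TensorProduct.ext <;> ext f <;> simp [hibiTensorMap]
  rw [h]
  exact (productMap_shift_injective P₁ P₂ K).comp
    (TensorProduct.map_injective_of_flat_flat (hibiRing K P₁).val.toLinearMap
      (hibiRing K P₂).val.toLinearMap Subtype.val_injective Subtype.val_injective)

theorem range_hibiTensorMap [PartialOrder P₁] [PartialOrder P₂] :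
    (hibiTensorMap P₁ P₂ K).range = hibiRing K (P₁ ⊕ₗ (PUnit ⊕ₗ P₂)) := by
  rw [hibiTensorMap, Algebra.TensorProduct.productMap_range, AlgHom.range_comp, AlgHom.range_comp,
    Subalgebra.range_val, Subalgebra.range_val, bottomShift, topShift,
    map_hibiShift_hibiRing K bottom_injective (Set.empty_disjoint _),
    map_hibiShift_hibiRing K top_injective disjoint_insert_middle_range_top,
    ← Algebra.adjoin_union, hibiRing]
  congr 1
  ext f
  simp only [isLowerSet_iff, Set.mem_union, Set.mem_ofPred_eq]
  constructor
  · rintro (⟨α, hα, rfl⟩ | ⟨β, hβ, rfl⟩)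
    exacts [⟨_, .inl ⟨α, hα, rfl⟩, rfl⟩, ⟨_, .inr ⟨β, hβ, rfl⟩, rfl⟩]
  · rintro ⟨_, ⟨α, hα, rfl⟩ | ⟨β, hβ, rfl⟩, rfl⟩
    exacts [.inl ⟨α, hα, rfl⟩, .inr ⟨β, hβ, rfl⟩]

end OrdinalSum

set_option synthInstance.maxHeartbeats 1000000 in
theorem stmt1 (K : Type*) [Field K] (P₁ P₂ : Type*)
    [Finite P₁] [Finite P₂] [PartialOrder P₁] [PartialOrder P₂] :
    Nonempty ((hibiRing K (P₁ ⊕ₗ (PUnit ⊕ₗ P₂))) ≃ₐ[K]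
      TensorProduct K (hibiRing K P₁) (hibiRing K P₂)) := by
  exact ⟨((AlgEquiv.ofInjective _ (OrdinalSum.hibiTensorMap_injective P₁ P₂ K)).trans
    (Subalgebra.equivOfEq _ _ (OrdinalSum.range_hibiTensorMap P₁ P₂ K))).symm⟩
end

section
/- Let K be a field and P a finite poset. Let P' be the set of all elements of P comparable to every element of P, and let P'' be the induced subposet of P on P \ P'. Then the Hibi ideal I_{I(P)} can be generated by a regular sequence of the polynomial ring K[x_α : α ∈ I(P)] (i.e., the Hibi ring R[I(P)] is a complete intersection) if and only if either P is a chain, or there exist n ≥ 1 and a bijection f : P'' → {1,…,n} × {1,2} such that for all p, q ∈ P'', p < q in P'' iff the first coordinate of f(p) is strictly less than the first coordinate of f(q) (i.e., P'' is the ordinal sum of n two-element antichains). -/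
open MvPolynomial

/-- The Hibi ideal `I_{I(P)}`: the kernel of the `K`-algebra map
`K[x_α : α ∈ I(P)] → K[t, z_p : p ∈ P]`, `x_α ↦ u_α`. -/
noncomputable def hibiIdeal (K : Type*) [Field K] (P : Type*) [Finite P] [PartialOrder P] :
    Ideal (MvPolynomial {α : Set P // IsLowerSet α} K) :=
  RingHom.ker
    (MvPolynomial.aeval
      (fun α : {α : Set P // IsLowerSet α} => hibiMonomial K (α : Set P)) :
      MvPolynomial {α : Set P // IsLowerSet α} K →ₐ[K] MvPolynomial (Option P) K)

set_option synthInstance.maxHeartbeats 1000000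
set_option maxHeartbeats 1000000

section RegularSequences

variable {R : Type*} [CommRing R]

theorem ideal_ofList_take_eq_span (rs : List R) (i : ℕ) (hi : i ≤ rs.length) :
    Ideal.ofList (rs.take i) = Ideal.span ((fun j => rs.getD j 0) '' Set.Iio i) := by
  unfold Ideal.ofList
  congr 1
  ext x
  simp only [Set.mem_ofPred_eq, List.mem_take_iff_getElem, Set.mem_image, Set.mem_Iio]
  constructor
  · rintro ⟨j, hj, rfl⟩
    exact ⟨j, by omega, by rw [List.getD_eq_getElem _ _ (by omega)]⟩
  · rintro ⟨j, hj, rfl⟩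
    exact ⟨j, by omega, by rw [List.getD_eq_getElem _ _ (by omega)]⟩

theorem isWeaklyRegular_self_iff (rs : List R) :
    RingTheory.Sequence.IsWeaklyRegular R rs ↔
      ∀ i < rs.length, ∀ x, rs.getD i 0 * x ∈ Ideal.span ((fun j => rs.getD j 0) '' Set.Iio i) →
        x ∈ Ideal.span ((fun j => rs.getD j 0) '' Set.Iio i) := by
  rw [RingTheory.Sequence.isWeaklyRegular_iff]
  refine forall_congr' fun i => forall_congr' fun hi => ?_
  rw [isSMulRegular_quotient_iff_mem_of_smul_mem, List.getD_eq_getElem _ _ hi,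
    ← ideal_ofList_take_eq_span rs i hi.le]
  simp

/-- The coefficients of a linear relation among the members of a regular sequence lie in the
ideal generated by the sequence. -/
theorem mem_span_of_sum_mul_eq_zero (r : ℕ → R) (n : ℕ)
    (hr : ∀ i < n, ∀ x, r i * x ∈ Ideal.span (r '' Set.Iio i) → x ∈ Ideal.span (r '' Set.Iio i))
    (b : ℕ → R) (hb : ∑ i ∈ Finset.range n, b i * r i = 0) :
    ∀ i < n, b i ∈ Ideal.span (r '' Set.Iio n) := by
  induction n generalizing b with
  | zero => simp
  | succ n ih =>
    have hmono : Ideal.span (r '' Set.Iio n) ≤ Ideal.span (r '' Set.Iio (n + 1)) :=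
      Ideal.span_mono (Set.image_mono (Set.Iio_subset_Iio (Nat.le_succ n)))
    have hrange : r '' Set.Iio n = Set.range fun i : Fin n => r i := by
      ext x
      simp [Fin.exists_iff]
    rw [Finset.sum_range_succ] at hb
    have hbn : b n ∈ Ideal.span (r '' Set.Iio n) := by
      refine hr n (Nat.lt_succ_self n) _ ?_
      rw [mul_comm, ← neg_eq_of_add_eq_zero_right hb]
      refine neg_mem (sum_mem fun i hi => Ideal.mul_mem_left _ _ (Ideal.subset_span ?_))
      exact Set.mem_image_of_mem _ (Finset.mem_range.1 hi)
    obtain ⟨c, hc⟩ := Ideal.mem_span_range_iff_exists_fun.1 (hrange ▸ hbn)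
    let c' : ℕ → R := fun i => if h : i < n then c ⟨i, h⟩ else 0
    have hc' : ∑ i ∈ Finset.range n, c' i * r i = b n := by
      rw [← hc, Finset.sum_range]
      simp [c']
    have key := ih (fun i hi => hr i (hi.trans (Nat.lt_succ_self n)))
      (fun i => b i + c' i * r n) (by
      rw [← hb, ← hc', Finset.sum_mul, ← Finset.sum_add_distrib]
      exact Finset.sum_congr rfl fun i _ => by ring)
    intro i hi
    rcases (Nat.lt_succ_iff_lt_or_eq).1 hi with hi | rfl
    · have hrn : c' i * r n ∈ Ideal.span (r '' Set.Iio (n + 1)) :=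
        Ideal.mul_mem_left _ _ (Ideal.subset_span ⟨n, Nat.lt_succ_self n, rfl⟩)
      exact (Ideal.add_mem_iff_left _ hrn).1 (hmono (key i hi))
    · exact hmono hbn

/-- If `I / I²` is free on `r`, and `I` is generated by `g` after localising at the kernel of
`ε`, then `r` has at most as many members as `g`. -/
theorem card_le_card_of_locally_generates {K : Type*} [Field K] (ε : R →+* K) {I : Ideal R}
    {κ ι : Type*} [Fintype κ] [Fintype ι] (r : κ → R) (hr : Ideal.span (Set.range r) = I)
    (hε : I ≤ RingHom.ker ε)
    (hrel : ∀ b : κ → R, ∑ i, b i * r i = 0 → ∀ i, b i ∈ I)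
    (g : ι → R) (hg : ∀ j, g j ∈ I)
    (hloc : ∀ f ∈ I, ∃ w, ε w = 1 ∧ w * f ∈ Ideal.span (Set.range g)) :
    Fintype.card κ ≤ Fintype.card ι := by
  classical
  subst hr
  choose w hw hwr using fun i => hloc (r i) (Ideal.subset_span ⟨i, rfl⟩)
  choose a ha using fun i => Ideal.mem_span_range_iff_exists_fun.1 (hwr i)
  choose b hb using fun j => Ideal.mem_span_range_iff_exists_fun.1 (hg j)
  let A : Matrix κ ι K := Matrix.of fun i j => ε (a i j)
  let B : Matrix ι κ K := Matrix.of fun j k => ε (b j k)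
  have hAB : A * B = 1 := by
    ext i k
    have h := hε (hrel (fun k => (if i = k then w i else 0) - ∑ j, a i j * b j k) (by
      simp_rw [sub_mul, Finset.sum_sub_distrib, Finset.sum_mul]
      rw [Finset.sum_comm]
      simp_rw [mul_assoc, ← Finset.mul_sum, hb, ha]
      simp) k)
    rw [RingHom.mem_ker, map_sub, sub_eq_zero] at h
    simp only [map_sum, map_mul] at h
    rw [Matrix.mul_apply, Matrix.one_apply]
    simp only [A, B, Matrix.of_apply]
    rw [← h]
    split_ifs <;> simp [hw]
  have h1 := Matrix.rank_mul_le_left A B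
  rw [hAB, Matrix.rank_one] at h1
  exact h1.trans (Matrix.rank_le_card_width A)

/-- An ideal without terms of degree at most one needs at least as many generators as it has
independent elements in degree two. -/
theorem card_le_card_of_quadrics {K σ : Type*} [Field K] {I : Ideal (MvPolynomial σ K)}
    {κ ι : Type*} [Fintype κ] [Fintype ι] [DecidableEq ι] (r : κ → MvPolynomial σ K)
    (hr : Ideal.span (Set.range r) = I)
    (hI : ∀ f ∈ I, ∀ m : σ →₀ ℕ, m.degree ≤ 1 → coeff m f = 0)
    (q : ι → MvPolynomial σ K) (hq : ∀ i, q i ∈ I) (m : ι → σ →₀ ℕ) (hm : ∀ i, (m i).degree = 2)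
    (hqm : ∀ i j, coeff (m j) (q i) = if i = j then 1 else 0) :
    Fintype.card ι ≤ Fintype.card κ := by
  classical
  subst hr
  choose c hc using fun i => Ideal.mem_span_range_iff_exists_fun.1 (hq i)
  let A : Matrix ι κ K := Matrix.of fun i k => coeff 0 (c i k)
  let B : Matrix κ ι K := Matrix.of fun k j => coeff (m j) (r k)
  have hAB : A * B = 1 := by
    ext i j
    rw [Matrix.mul_apply, Matrix.one_apply, ← hqm, ← hc, coeff_sum]
    refine Finset.sum_congr rfl fun k _ => ?_
    rw [coeff_mul, Finset.sum_eq_single (0, m j)]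
    · rfl
    · rintro ⟨x, y⟩ hxy hne
      rw [Finset.HasAntidiagonal.mem_antidiagonal] at hxy
      have hx : x ≠ 0 := by
        rintro rfl
        exact hne (by simpa using hxy)
      have hd : x.degree + y.degree = 2 := by rw [← map_add, hxy, hm]
      have hx' : x.degree ≠ 0 := fun h => hx ((Finsupp.degree_eq_zero_iff x).1 h)
      rw [hI (r k) (Ideal.subset_span ⟨k, rfl⟩) y (by omega), mul_zero]
    · intro h
      simp at h
  have h1 := Matrix.rank_mul_le_left A B
  rw [hAB, Matrix.rank_one] at h1
  exact h1.trans (Matrix.rank_le_card_width A)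

end RegularSequences

section MonomialMaps

variable {K σ τ : Type*} [Field K]

theorem aeval_monomial_monomial (v : σ → τ →₀ ℕ) (s : σ →₀ ℕ) (c : K) :
    aeval (fun a => monomial (v a) (1 : K)) (monomial s c) =
      monomial (Finsupp.linearCombination ℕ v s) c := by
  rw [aeval_monomial, Finsupp.linearCombination_apply, algebraMap_eq, Finsupp.prod, Finsupp.sum]
  simp only [monomial_pow, one_pow]
  rw [← monomial_sum_one, C_mul_monomial, mul_one]

theorem coeff_aeval_monomial (v : σ → τ →₀ ℕ) (m : σ →₀ ℕ)
    (hm : ∀ m', Finsupp.linearCombination ℕ v m' = Finsupp.linearCombination ℕ v m → m' = m)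
    (f : MvPolynomial σ K) :
    coeff (Finsupp.linearCombination ℕ v m) (aeval (fun a => monomial (v a) (1 : K)) f) =
      coeff m f := by
  classical
  induction f using MvPolynomial.induction_on' with
  | monomial s c =>
    rw [aeval_monomial_monomial, coeff_monomial, coeff_monomial]
    refine if_congr ⟨hm s, fun h => by rw [h]⟩ rfl rfl
  | add p q hp hq => rw [map_add, coeff_add, coeff_add, hp, hq]

/-- The kernel of a monomial map lies in any ideal containing all the pure difference
binomials of the kernel. -/
theorem ker_aeval_monomial_le (v : σ → τ →₀ ℕ) (J : Ideal (MvPolynomial σ K))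
    (hJ : ∀ s s', Finsupp.linearCombination ℕ v s = Finsupp.linearCombination ℕ v s' →
      monomial s 1 - monomial s' 1 ∈ J) :
    RingHom.ker (aeval (fun a => monomial (v a) (1 : K)) :
      MvPolynomial σ K →ₐ[K] MvPolynomial τ K) ≤ J := by
  let ρ := Function.invFun (Finsupp.linearCombination ℕ v)
  have hρ : ∀ s, Finsupp.linearCombination ℕ v (ρ (Finsupp.linearCombination ℕ v s)) =
      Finsupp.linearCombination ℕ v s := fun s => Function.invFun_eq ⟨s, rfl⟩
  let G : MvPolynomial τ K →ₗ[K] MvPolynomial σ K :=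
    (basisMonomials τ K).constr K fun w => monomial (ρ w) 1
  have hG : ∀ w (c : K), G (monomial w c) = monomial (ρ w) c := by
    intro w c
    have h1 : (monomial w c : MvPolynomial τ K) = c • basisMonomials τ K w := by
      rw [coe_basisMonomials, smul_monomial, smul_eq_mul, mul_one]
    rw [h1, map_smul, Module.Basis.constr_basis, smul_monomial, smul_eq_mul, mul_one]
  have key : ∀ f : MvPolynomial σ K, f - G (aeval (fun a => monomial (v a) (1 : K)) f) ∈ J := by
    intro f
    induction f using MvPolynomial.induction_on' with
    | monomial s c =>
      rw [aeval_monomial_monomial, hG]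
      have := J.mul_mem_left (C c) (hJ s (ρ (Finsupp.linearCombination ℕ v s)) (hρ s).symm)
      simpa [mul_sub, C_mul_monomial] using this
    | add p q hp hq =>
      rw [map_add, map_add, add_sub_add_comm]
      exact add_mem hp hq
  intro f hf
  have hf' := key f
  rw [RingHom.mem_ker] at hf
  rwa [hf, map_zero, sub_zero] at hf'

end MonomialMaps

section OrderIdeals

/-- The order ideals of `P`, which index the variables. -/
abbrev OrderIdeal (P : Type*) [PartialOrder P] := {α : Set P // IsLowerSet α}

variable {P : Type*} [PartialOrder P]

/-- The intersection of two order ideals. -/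
def OrderIdeal.inter (α β : OrderIdeal P) : OrderIdeal P := ⟨α.1 ∩ β.1, α.2.inter β.2⟩

/-- The union of two order ideals. -/
def OrderIdeal.union (α β : OrderIdeal P) : OrderIdeal P := ⟨α.1 ∪ β.1, α.2.union β.2⟩

/-- Two order ideals are incomparable if neither contains the other. -/
def OrderIdeal.Incomp (α β : OrderIdeal P) : Prop := ¬ α.1 ⊆ β.1 ∧ ¬ β.1 ⊆ α.1

/-- The Hibi relation `x_α x_β - x_{α ∩ β} x_{α ∪ β}`. -/
noncomputable def hibiRelation (K : Type*) [Field K] (α β : OrderIdeal P) :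
    MvPolynomial (OrderIdeal P) K :=
  X α * X β - X (α.inter β) * X (α.union β)

theorem hibiRelation_eq (K : Type*) [Field K] (α β : OrderIdeal P) :
    hibiRelation K α β = monomial (Finsupp.single α 1 + Finsupp.single β 1) 1 -
      monomial (Finsupp.single (α.inter β) 1 + Finsupp.single (α.union β) 1) 1 := by
  simp only [hibiRelation, X, monomial_mul, one_mul]

theorem eq_or_eq_of_single_add_single {α β γ δ : OrderIdeal P}
    (h : Finsupp.single α 1 + Finsupp.single β 1 =
      (Finsupp.single γ 1 + Finsupp.single δ 1 : OrderIdeal P →₀ ℕ)) : α = γ ∨ α = δ := by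
  classical
  by_contra! hne
  have := DFunLike.congr_fun h α
  simp [Finsupp.single_apply, hne.1.symm, hne.2.symm] at this

theorem single_inter_add_single_union_ne {α β γ δ : OrderIdeal P} (h : γ.Incomp δ) :
    (Finsupp.single (α.inter β) 1 + Finsupp.single (α.union β) 1 : OrderIdeal P →₀ ℕ) ≠
      Finsupp.single γ 1 + Finsupp.single δ 1 := by
  intro he
  have hsub : (α.inter β).1 ⊆ (α.union β).1 :=
    Set.inter_subset_left.trans Set.subset_union_left
  have h1 := eq_or_eq_of_single_add_single he.symm
  have h2 := eq_or_eq_of_single_add_single ((add_comm _ _).trans he.symm)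
  rcases h1 with rfl | rfl <;> rcases h2 with rfl | rfl
  · exact h.1 subset_rfl
  · exact h.1 hsub
  · exact h.2 hsub
  · exact h.1 subset_rfl

open Classical in
theorem coeff_hibiRelation (K : Type*) [Field K] (α β : OrderIdeal P) {γ δ : OrderIdeal P}
    (h : γ.Incomp δ) :
    coeff (Finsupp.single γ 1 + Finsupp.single δ 1) (hibiRelation K α β) =
      if (Finsupp.single α 1 + Finsupp.single β 1 : OrderIdeal P →₀ ℕ) =
        Finsupp.single γ 1 + Finsupp.single δ 1 then 1 else 0 := by
  rw [hibiRelation_eq, coeff_sub, coeff_monomial, coeff_monomial,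
    if_neg (single_inter_add_single_union_ne h), sub_zero]

/-- The principal order ideal of `p`. -/
def principalIdeal (p : P) : OrderIdeal P := ⟨Set.Iic p, isLowerSet_Iic p⟩

theorem principalIdeal_incomp {p q : P} (hpq : ¬ p ≤ q) (hqp : ¬ q ≤ p) :
    (principalIdeal p).Incomp (principalIdeal q) :=
  ⟨fun h => hpq (h le_rfl), fun h => hqp (h le_rfl)⟩

end OrderIdeals

section HibiBasics

/-- The exponent vector of the Hibi monomial `u_α`. -/
noncomputable def hibiExp {P : Type*} [Finite P] (α : Set P) : Option P →₀ ℕ :=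
  Finsupp.single none 1 + ∑ p ∈ (Set.toFinite α).toFinset, Finsupp.single (some p) 1

theorem hibiMonomial_eq_monomial (K : Type*) [Field K] {P : Type*} [Finite P] (α : Set P) :
    hibiMonomial K α = monomial (hibiExp α) 1 := by
  rw [hibiMonomial, hibiExp, ← one_mul (1 : K), ← monomial_mul, monomial_sum_one]
  rfl

theorem hibiExp_none {P : Type*} [Finite P] (α : Set P) : hibiExp α none = 1 := by
  simp [hibiExp]

open Classical in
theorem hibiExp_some {P : Type*} [Finite P] (α : Set P) (p : P) :
    hibiExp α (some p) = if p ∈ α then 1 else 0 := by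
  simp [hibiExp, Finsupp.single_apply]

theorem hibiExp_injective {P : Type*} [Finite P] :
    Function.Injective (hibiExp : Set P → Option P →₀ ℕ) := by
  classical
  intro α β h
  ext p
  have := DFunLike.congr_fun h (some p)
  rw [hibiExp_some, hibiExp_some] at this
  split_ifs at this <;> simp_all

variable {P : Type*} [Finite P] [PartialOrder P]

/-- The multidegree in `K[t, z_p]` of the monomial with exponent vector `s`. -/
noncomputable def hibiWeight (s : OrderIdeal P →₀ ℕ) : Option P →₀ ℕ :=
  Finsupp.linearCombination ℕ (fun α : OrderIdeal P => hibiExp α.1) s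

theorem hibiWeight_apply [Fintype (OrderIdeal P)] (s : OrderIdeal P →₀ ℕ) (x : Option P) :
    hibiWeight s x = ∑ α, s α * hibiExp α.1 x := by
  rw [hibiWeight, Finsupp.linearCombination_apply, Finsupp.sum_fintype _ _ (by simp)]
  simp [Finsupp.finsetSum_apply]

theorem hibiWeight_none (s : OrderIdeal P →₀ ℕ) : hibiWeight s none = s.degree := by
  classical
  have := Fintype.ofFinite (OrderIdeal P)
  rw [hibiWeight_apply, Finsupp.degree_eq_sum]
  simp [hibiExp_none]

theorem hibiIdeal_eq_ker (K : Type*) [Field K] :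
    hibiIdeal K P = RingHom.ker (aeval (fun α : OrderIdeal P => monomial (hibiExp α.1) (1 : K)) :
      MvPolynomial (OrderIdeal P) K →ₐ[K] MvPolynomial (Option P) K) := by
  simp only [hibiIdeal, hibiMonomial_eq_monomial]

theorem coeff_eq_zero_of_mem_hibiIdeal {K : Type*} [Field K]
    (f : MvPolynomial (OrderIdeal P) K) (hf : f ∈ hibiIdeal K P) (m : OrderIdeal P →₀ ℕ)
    (hm : m.degree ≤ 1) : coeff m f = 0 := by
  rw [hibiIdeal_eq_ker, RingHom.mem_ker] at hf
  rw [← coeff_aeval_monomial (fun α : OrderIdeal P => hibiExp α.1) m _ f, hf, coeff_zero]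
  intro m' h
  change hibiWeight m' = hibiWeight m at h
  have hd : m'.degree = m.degree := by rw [← hibiWeight_none, ← hibiWeight_none, h]
  rcases Nat.le_one_iff_eq_zero_or_eq_one.1 hm with h0 | h1
  · rw [(Finsupp.degree_eq_zero_iff m).1 h0, (Finsupp.degree_eq_zero_iff m').1 (hd.trans h0)]
  · obtain ⟨a, rfl⟩ := (Finsupp.sum_eq_one_iff m).1 h1
    obtain ⟨b, rfl⟩ := (Finsupp.sum_eq_one_iff m').1 (hd.trans h1)
    simp only [hibiWeight, Finsupp.linearCombination_single, one_smul] at h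
    rw [Subtype.ext (hibiExp_injective h)]

theorem hibiExp_inter_add_union (α β : OrderIdeal P) :
    hibiExp (α.inter β).1 + hibiExp (α.union β).1 = hibiExp α.1 + hibiExp β.1 := by
  classical
  ext x
  rcases x with _ | p
  · simp only [Finsupp.add_apply, hibiExp_none]
  · simp only [Finsupp.add_apply, hibiExp_some, OrderIdeal.inter, OrderIdeal.union,
      Set.mem_inter_iff, Set.mem_union]
    by_cases h1 : p ∈ α.1 <;> by_cases h2 : p ∈ β.1 <;> simp [h1, h2]

theorem hibiRelation_mem (K : Type*) [Field K] (α β : OrderIdeal P) :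
    hibiRelation K α β ∈ hibiIdeal K P := by
  rw [hibiIdeal_eq_ker, RingHom.mem_ker, hibiRelation_eq, map_sub, aeval_monomial_monomial,
    aeval_monomial_monomial]
  simp only [map_add, Finsupp.linearCombination_single, one_smul]
  rw [hibiExp_inter_add_union, sub_self]

end HibiBasics

section MaximalChains

theorem ncard_le_of_equiv {P : Type*} [Finite P] {n : ℕ} (e : P ≃ Fin n) (α : Set P) :
    α.ncard ≤ n := by
  rw [← Nat.card_fin n, ← Nat.card_congr e, ← Set.ncard_univ]
  exact Set.ncard_le_ncard (Set.subset_univ _)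

variable {P : Type*} [PartialOrder P] {n : ℕ}

/-- The order ideal of the first `i` elements in a linear extension `e`. -/
def initialIdeal (e : P ≃ Fin n) (he : Monotone e) (i : ℕ) : OrderIdeal P :=
  ⟨{p | (e p : ℕ) < i}, fun _ _ hab ha => lt_of_le_of_lt (Fin.val_le_of_le (he hab)) ha⟩

/-- A linear extension refining a given monotone function. -/
theorem exists_linearExtension [Finite P] (k : P → ℕ) (hk : Monotone k) :
    ∃ (n : ℕ) (e : P ≃ Fin n), Monotone e ∧ ∀ p q, k p < k q → e p < e q := by
  classical
  let φ : P → ℕ ×ₗ LinearExtension P := fun p => toLex (k p, toLinearExtension p)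
  have hφ : Function.Injective φ := fun p q h => congrArg (fun x => (ofLex x).2) h
  have := Fintype.ofFinite (Set.range φ)
  let o := monoEquivOfFin (Set.range φ) rfl
  let e := (Equiv.ofInjective φ hφ).trans o.symm.toEquiv
  have he : ∀ {p q}, φ p < φ q → e p < e q := fun {p q} h => o.symm.lt_iff_lt.2 h
  refine ⟨_, e, ?_, fun p q hpq => he (Prod.Lex.left _ _ hpq)⟩
  intro p q hpq
  rcases hpq.eq_or_lt with rfl | hlt
  · rfl
  · refine (he ?_).le
    rcases (hk hpq).lt_or_eq with h | h
    · exact Prod.Lex.left _ _ h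
    · refine Prod.Lex.toLex_lt_toLex.2 (Or.inr ⟨h, ?_⟩)
      exact lt_of_le_of_ne (toLinearExtension.monotone hpq) fun h => hlt.ne h

theorem initialIdeal_mono (e : P ≃ Fin n) (he : Monotone e) {i j : ℕ} (hij : i ≤ j) :
    (initialIdeal e he i).1 ⊆ (initialIdeal e he j).1 :=
  fun _ hp => lt_of_lt_of_le hp hij

theorem not_incomp_initialIdeal (e : P ≃ Fin n) (he : Monotone e) (i j : ℕ) :
    ¬ (initialIdeal e he i).Incomp (initialIdeal e he j) := by
  intro h
  rcases le_total i j with hij | hij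
  · exact h.1 (initialIdeal_mono e he hij)
  · exact h.2 (initialIdeal_mono e he hij)

theorem ncard_initialIdeal (e : P ≃ Fin n) (he : Monotone e) {i : ℕ} (hi : i ≤ n) :
    (initialIdeal e he i).1.ncard = i := by
  have h : (initialIdeal e he i).1 = e.symm '' {j : Fin n | (j : ℕ) < i} := by
    ext p
    simp [initialIdeal]
  rw [h, Set.ncard_image_of_injective _ e.symm.injective, Set.ncard_eq_toFinset_card']
  simp [Fin.card_filter_val_lt, hi]

theorem eq_initialIdeal_ncard_of_not_incomp [Finite P] (e : P ≃ Fin n) (he : Monotone e)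
    (α : OrderIdeal P) (h : ¬ α.Incomp (initialIdeal e he α.1.ncard)) :
    α = initialIdeal e he α.1.ncard := by
  have hc := ncard_initialIdeal e he (ncard_le_of_equiv e α.1)
  rw [OrderIdeal.Incomp, not_and_or, not_not, not_not] at h
  rcases h with h | h
  · exact Subtype.ext (Set.eq_of_subset_of_ncard_le h hc.le)
  · exact Subtype.ext (Set.eq_of_subset_of_ncard_le h hc.ge).symm

theorem eq_initialIdeal_ncard [Finite P] (e : P ≃ Fin n) (he : Monotone e) (α : OrderIdeal P)
    (h : ∀ p ∈ α.1, ∀ q ∉ α.1, e p < e q) : α = initialIdeal e he α.1.ncard := by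
  refine eq_initialIdeal_ncard_of_not_incomp e he α fun hinc => ?_
  obtain ⟨p, hp, hp'⟩ := Set.not_subset.1 hinc.1
  obtain ⟨q, hq, hq'⟩ := Set.not_subset.1 hinc.2
  have h1 : (e p : ℕ) < e q := h p hp q hq'
  exact hp' (h1.trans hq)

variable [Finite P]

/-- For a linear extension `e` with initial ideals `c₀ ⊂ … ⊂ cₙ`, the binomial expressing `x_α`
as a Laurent monomial in the variables `x_{c_i}`. -/
noncomputable def chainRelation (K : Type*) [Field K] (e : P ≃ Fin n) (he : Monotone e)
    (α : OrderIdeal P) : MvPolynomial (OrderIdeal P) K :=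
  X α * ∏ p ∈ (Set.toFinite α.1).toFinset, X (initialIdeal e he (e p)) -
    X (initialIdeal e he 0) * ∏ p ∈ (Set.toFinite α.1).toFinset, X (initialIdeal e he (e p + 1))

open Classical in
theorem toFinset_initialIdeal_succ (e : P ≃ Fin n) (he : Monotone e) (p : P) :
    (Set.toFinite (initialIdeal e he (e p + 1)).1).toFinset =
      insert p (Set.toFinite (initialIdeal e he (e p)).1).toFinset := by
  ext q
  rw [Set.Finite.mem_toFinset, Finset.mem_insert, Set.Finite.mem_toFinset]
  change (e q : ℕ) < e p + 1 ↔ q = p ∨ (e q : ℕ) < e p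
  rw [Nat.lt_succ_iff_lt_or_eq, Fin.val_inj, e.apply_eq_iff_eq, or_comm]

theorem mul_prod_initialIdeal_div {G : Type*} [CommGroup G] (e : P ≃ Fin n) (he : Monotone e)
    (ξ : ℕ → G) (i : ℕ) (hi : i ≤ n) :
    ξ 0 * ∏ p ∈ (Set.toFinite (initialIdeal e he i).1).toFinset, ξ (e p + 1) / ξ (e p) = ξ i := by
  classical
  induction i with
  | zero => simp [initialIdeal]
  | succ i ih =>
    obtain ⟨p, hp⟩ : ∃ p, (e p : ℕ) = i := ⟨e.symm ⟨i, hi⟩, by simp⟩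
    have ih' := ih (by omega)
    subst hp
    rw [toFinset_initialIdeal_succ, Finset.prod_insert (by simp [initialIdeal]), mul_left_comm, ih',
      div_mul_cancel]

theorem hibiMonomial_initialIdeal_succ (K : Type*) [Field K] (e : P ≃ Fin n) (he : Monotone e)
    (p : P) : hibiMonomial K (initialIdeal e he (e p + 1)).1 =
      hibiMonomial K (initialIdeal e he (e p)).1 * X (some p) := by
  classical
  rw [hibiMonomial, hibiMonomial, toFinset_initialIdeal_succ,
    Finset.prod_insert (by simp [initialIdeal])]
  ring

theorem chainRelation_mem (K : Type*) [Field K] (e : P ≃ Fin n) (he : Monotone e)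
    (α : OrderIdeal P) : chainRelation K e he α ∈ hibiIdeal K P := by
  have h0 : hibiMonomial K (initialIdeal e he 0).1 = X none := by
    simp [hibiMonomial, initialIdeal]
  rw [hibiIdeal, RingHom.mem_ker, chainRelation]
  simp only [map_sub, map_mul, map_prod, aeval_X, hibiMonomial_initialIdeal_succ, h0,
    Finset.prod_mul_distrib]
  rw [hibiMonomial]
  ring

theorem exists_mul_mem_span_chainRelation (K : Type*) [Field K] (e : P ≃ Fin n) (he : Monotone e)
    (f : MvPolynomial (OrderIdeal P) K) (hf : f ∈ hibiIdeal K P) :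
    ∃ w, eval (fun _ => (1 : K)) w = 1 ∧ w * f ∈ Ideal.span (Set.range
      fun α : {α : OrderIdeal P // ∀ i, α ≠ initialIdeal e he i} => chainRelation K e he α.1) := by
  classical
  set c := initialIdeal e he with hcdef
  set J := Ideal.span (Set.range
      fun α : {α : OrderIdeal P // ∀ i, α ≠ c i} => chainRelation K e he α.1) with hJ
  let W : Submonoid (MvPolynomial (OrderIdeal P) K) :=
    (⊥ : Submonoid K).comap (eval fun _ => (1 : K))
  let A := MvPolynomial (OrderIdeal P) K ⧸ J
  let Q := Localization (W.map (Ideal.Quotient.mk J))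
  let ι : MvPolynomial (OrderIdeal P) K →ₐ[K] Q := Algebra.ofId A Q |>.restrictScalars K |>.comp
    (Ideal.Quotient.mkₐ K J)
  have hι : ∀ x, ι x = algebraMap A Q (Ideal.Quotient.mk J x) := fun x => rfl
  have hιJ : ∀ x ∈ J, ι x = 0 := fun x hx => by
    rw [hι, Ideal.Quotient.eq_zero_iff_mem.2 hx, map_zero]
  have hunit : ∀ α, IsUnit (ι (X α)) := fun α =>
    IsLocalization.map_units Q (⟨Ideal.Quotient.mk J (X α),
      X α, by simp [W], rfl⟩ : W.map (Ideal.Quotient.mk J))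
  let ξ : ℕ → Qˣ := fun i => (hunit (c i)).unit
  have hξ : ∀ i, (ξ i : Q) = ι (X (c i)) := fun i => rfl
  let θ : MvPolynomial (Option P) K →ₐ[K] Q := aeval fun x : Option P =>
    x.elim (ξ 0 : Q) fun p => ((ξ (e p + 1) / ξ (e p) : Qˣ) : Q)
  have hθ : ∀ α : OrderIdeal P, θ (hibiMonomial K α.1) =
      ((ξ 0 * ∏ p ∈ (Set.toFinite α.1).toFinset, ξ (e p + 1) / ξ (e p) : Qˣ) : Q) := by
    intro α
    simp only [θ, hibiMonomial, map_mul, map_prod, aeval_X, Option.elim, Units.val_mul,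
      Units.coe_prod]
  have hX : ∀ α : OrderIdeal P, θ (hibiMonomial K α.1) = ι (X α) := by
    intro α
    rw [hθ]
    by_cases hα : ∃ i, α = c i
    · have hα' : α = c α.1.ncard := eq_initialIdeal_ncard_of_not_incomp e he α (by
        obtain ⟨i, hi⟩ := hα
        rw [hi]
        exact not_incomp_initialIdeal e he _ _)
      rw [hα', mul_prod_initialIdeal_div e he ξ _ (ncard_le_of_equiv e _)]
      exact hξ _
    · push Not at hα
      have h0 := hιJ _ (Ideal.subset_span ⟨⟨α, hα⟩, rfl⟩)
      simp only [chainRelation, map_sub, map_mul, map_prod, sub_eq_zero] at h0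
      have hu := Units.isUnit (∏ p ∈ (Set.toFinite α.1).toFinset, ξ (e p))
      refine hu.mul_right_cancel ?_
      rw [← Units.val_mul, mul_assoc, ← Finset.prod_mul_distrib]
      simp only [div_mul_cancel, Units.val_mul, Units.coe_prod, hξ]
      exact h0.symm
  have hcomp : θ.comp (aeval fun α : OrderIdeal P => hibiMonomial K α.1) = ι := by
    ext α
    simp [hX]
  have hιf : ι f = 0 := by
    rw [← hcomp, AlgHom.comp_apply]
    rw [hibiIdeal, RingHom.mem_ker] at hf
    rw [hf, map_zero]
  rw [hι, IsLocalization.map_eq_zero_iff (W.map (Ideal.Quotient.mk J))] at hιf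
  obtain ⟨⟨_, w, hw, rfl⟩, hwf⟩ := hιf
  refine ⟨w, by simpa [W] using hw, ?_⟩
  rw [← Ideal.Quotient.eq_zero_iff_mem, map_mul]
  exact hwf

end MaximalChains

section Necessity

variable {P : Type*} [Finite P] [PartialOrder P]

/-- If the Hibi ideal is generated by a regular sequence, then for every maximal chain of order
ideals each incomparable pair consists of some `α` off the chain and the member of the chain
having the same cardinality as `α`. -/
theorem exists_single_add_single_eq {K : Type*} [Field K]
    {rs : List (MvPolynomial (OrderIdeal P) K)}
    (hrs : RingTheory.Sequence.IsWeaklyRegular (MvPolynomial (OrderIdeal P) K) rs)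
    (hI : Ideal.span {f | f ∈ rs} = hibiIdeal K P) {n : ℕ} (e : P ≃ Fin n) (he : Monotone e)
    {β γ : OrderIdeal P} (h : β.Incomp γ) :
    ∃ α : OrderIdeal P, (∀ i, α ≠ initialIdeal e he i) ∧
      (Finsupp.single β 1 + Finsupp.single γ 1 : OrderIdeal P →₀ ℕ) =
        Finsupp.single α 1 + Finsupp.single (initialIdeal e he α.1.ncard) 1 := by
  classical
  by_contra! hne
  have := Fintype.ofFinite (OrderIdeal P)
  let H := {α : OrderIdeal P // ∀ i, α ≠ initialIdeal e he i}
  let r : Fin rs.length → MvPolynomial (OrderIdeal P) K := fun i => rs.getD i 0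
  have himg : (fun j => rs.getD j 0) '' Set.Iio rs.length = Set.range r := by
    ext x
    exact ⟨fun ⟨j, hj, h⟩ => ⟨⟨j, hj⟩, h⟩, fun ⟨j, h⟩ => ⟨j, j.2, h⟩⟩
  have hlist : Ideal.ofList rs = Ideal.span (Set.range r) := by
    rw [← himg, ← ideal_ofList_take_eq_span rs _ le_rfl, List.take_length]
  have hr : Ideal.span (Set.range r) = hibiIdeal K P := by
    rw [← hlist, ← hI]
  have hrel : ∀ b : Fin rs.length → MvPolynomial (OrderIdeal P) K, ∑ i, b i * r i = 0 →
      ∀ i, b i ∈ hibiIdeal K P := by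
    intro b hb i
    have key := mem_span_of_sum_mul_eq_zero (fun j => rs.getD j 0) rs.length
      ((isWeaklyRegular_self_iff rs).1 hrs) (fun j => if hj : j < rs.length then b ⟨j, hj⟩ else 0)
      (by rw [Finset.sum_range, ← hb]; simp [r]) i i.2
    rw [himg, hr] at key
    simpa using key
  have hle : hibiIdeal K P ≤ RingHom.ker (eval fun _ : OrderIdeal P => (1 : K)) := by
    intro f hf
    rw [hibiIdeal, RingHom.mem_ker] at hf
    have h1 : (aeval fun _ : Option P => (1 : K)).comp
        (aeval fun α : OrderIdeal P => hibiMonomial K α.1) = aeval fun _ => (1 : K) := by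
      ext α
      simp [hibiMonomial]
    have h2 := DFunLike.congr_fun h1 f
    rw [AlgHom.comp_apply, hf, map_zero] at h2
    exact h2.symm
  have hupper := card_le_card_of_locally_generates (eval fun _ : OrderIdeal P => (1 : K)) r hr hle
    hrel (fun α : H => chainRelation K e he α.1) (fun α => chainRelation_mem K e he α.1)
    (exists_mul_mem_span_chainRelation K e he)
  let v : Option H → OrderIdeal P × OrderIdeal P := fun x =>
    x.elim (β, γ) fun α => (α.1, initialIdeal e he α.1.1.ncard)
  let m : Option H → OrderIdeal P →₀ ℕ := fun x =>
    Finsupp.single (v x).1 1 + Finsupp.single (v x).2 1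
  have hv : ∀ x, (v x).1.Incomp (v x).2 := by
    rintro (_ | α)
    · exact h
    · by_contra hc
      exact α.2 _ (eq_initialIdeal_ncard_of_not_incomp e he α.1 hc)
  have hm : Function.Injective m := by
    rintro (_ | α) (_ | α') hx
    · rfl
    · exact absurd hx (hne _ α'.2)
    · exact absurd hx.symm (hne _ α.2)
    · rcases eq_or_eq_of_single_add_single hx with h1 | h1
      · exact congrArg some (Subtype.ext h1)
      · exact absurd h1 (α.2 _)
  have hlower := card_le_card_of_quadrics r hr coeff_eq_zero_of_mem_hibiIdeal
    (fun x : Option H => hibiRelation K (v x).1 (v x).2) (fun x => hibiRelation_mem K _ _) m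
    (fun x => by simp [m]) (fun x y => by
      rw [coeff_hibiRelation K _ _ (hv y)]
      exact if_congr hm.eq_iff rfl rfl)
  rw [Fintype.card_option] at hlower
  omega

theorem subsingleton_incomparable_of_regular {K : Type*} [Field K]
    {rs : List (MvPolynomial (OrderIdeal P) K)}
    (hrs : RingTheory.Sequence.IsWeaklyRegular (MvPolynomial (OrderIdeal P) K) rs)
    (hI : Ideal.span {f | f ∈ rs} = hibiIdeal K P) {p q r : P}
    (hpq : ¬ p ≤ q) (hqp : ¬ q ≤ p) (hpr : ¬ p ≤ r) (hrp : ¬ r ≤ p) : q = r := by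
  classical
  have hne : ∀ {q r : P}, ¬ p ≤ q → ¬ q ≤ p → ¬ p ≤ r → ¬ r ≤ p → ¬ q < r := by
    intro q r hpq hqp hpr hrp hqr
    obtain ⟨n, e, he, hk⟩ := exists_linearExtension
      (fun x => if x ≤ q then 0 else if x ≤ r then 1 else 2) (by
        intro x y hxy
        dsimp only
        by_cases h1 : y ≤ q
        · simp [hxy.trans h1]
        · by_cases h2 : y ≤ r
          · simp only [if_neg h1, if_pos h2, if_pos (hxy.trans h2)]
            split_ifs <;> omega
          · simp only [if_neg h1, if_neg h2]
            split_ifs <;> omega)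
    have hq : principalIdeal q = initialIdeal e he (principalIdeal q).1.ncard := by
      refine eq_initialIdeal_ncard e he _ fun x hx y hy => hk x y ?_
      have hx : x ≤ q := hx
      have hy : ¬ y ≤ q := hy
      simp only [if_pos hx, if_neg hy]
      split_ifs <;> omega
    have hr : principalIdeal r = initialIdeal e he (principalIdeal r).1.ncard := by
      refine eq_initialIdeal_ncard e he _ fun x hx y hy => hk x y ?_
      have hx : x ≤ r := hx
      have hy : ¬ y ≤ r := hy
      have hy' : ¬ y ≤ q := fun h => hy (h.trans hqr.le)
      simp only [if_pos hx, if_neg hy, if_neg hy']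
      split_ifs <;> omega
    have key : ∀ i, (principalIdeal p).Incomp (initialIdeal e he i) →
        initialIdeal e he i = initialIdeal e he (principalIdeal p).1.ncard := by
      intro i hi
      obtain ⟨α, hα, heq⟩ := exists_single_add_single_eq hrs hI e he hi
      have h1 : α = principalIdeal p := by
        rcases eq_or_eq_of_single_add_single heq.symm with h | h
        · exact h
        · exact absurd h (hα i)
      subst h1
      exact Finsupp.single_left_injective one_ne_zero (add_left_cancel heq)
    have hqr' : principalIdeal q = principalIdeal r := by
      exact hq.trans ((key _ (hq ▸ principalIdeal_incomp hpq hqp)).trans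
        ((key _ (hr ▸ principalIdeal_incomp hpr hrp)).symm.trans hr.symm))
    have : r ∈ (principalIdeal q).1 := hqr' ▸ (le_rfl : r ≤ r)
    exact hqr.not_ge this
  by_contra hqr
  have h1 : ¬ q ≤ r := fun h => hne hpq hqp hpr hrp (lt_of_le_of_ne h hqr)
  have h2 : ¬ r ≤ q := fun h => hne hpr hrp hpq hqp (lt_of_le_of_ne h (Ne.symm hqr))
  obtain ⟨n, e, he, hk⟩ := exists_linearExtension (fun x => if x ≤ p then 0 else 1) (by
    intro x y hxy
    dsimp only
    by_cases h1 : y ≤ p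
    · simp [hxy.trans h1]
    · simp only [if_neg h1]
      split_ifs <;> omega)
  have hp : principalIdeal p = initialIdeal e he (principalIdeal p).1.ncard := by
    refine eq_initialIdeal_ncard e he _ fun x hx y hy => hk x y ?_
    have hx : x ≤ p := hx
    have hy : ¬ y ≤ p := hy
    simp only [if_pos hx, if_neg hy]
    omega
  obtain ⟨α, hα, heq⟩ := exists_single_add_single_eq hrs hI e he (principalIdeal_incomp h1 h2)
  rcases eq_or_eq_of_single_add_single ((add_comm _ _).trans heq.symm) with h | h
  · exact not_incomp_initialIdeal e he _ _ (hp ▸ h ▸ principalIdeal_incomp hpq hqp)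
  · exact not_incomp_initialIdeal e he _ _ (hp ▸ h ▸ principalIdeal_incomp hpr hrp)

end Necessity

section IncomparablePairs

/-- The incomparable pairs of `P` are exactly the pairwise disjoint pairs `{p i, q i}`. -/
structure IncomparablePairs {P : Type*} [PartialOrder P] {n : ℕ} (p q : Fin n → P) : Prop where
  not_le : ∀ i, ¬ p i ≤ q i
  not_ge : ∀ i, ¬ q i ≤ p i
  exists_eq : ∀ a b, ¬ a ≤ b → ¬ b ≤ a → ∃ i, (a = p i ∧ b = q i) ∨ (a = q i ∧ b = p i)
  ne : ∀ i j, p i ≠ q j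
  left_injective : Function.Injective p
  right_injective : Function.Injective q

namespace IncomparablePairs

variable {P : Type*} [PartialOrder P] {n : ℕ} {p q : Fin n → P}

theorem symm (h : IncomparablePairs p q) : IncomparablePairs q p where
  not_le := h.not_ge
  not_ge := h.not_le
  exists_eq a b hab hba := (h.exists_eq a b hab hba).imp fun _ => Or.symm
  ne i j := (h.ne j i).symm
  left_injective := h.right_injective
  right_injective := h.left_injective

theorem eq_left (h : IncomparablePairs p q) {i : Fin n} {x : P} (h1 : ¬ x ≤ q i)
    (h2 : ¬ q i ≤ x) : x = p i := by
  obtain ⟨j, ⟨rfl, hj⟩ | ⟨-, hj⟩⟩ := h.exists_eq x (q i) h1 h2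
  · rw [h.right_injective hj]
  · exact absurd hj.symm (h.ne j i)

theorem eq_principalIdeal (h : IncomparablePairs p q) {i : Fin n} {α : OrderIdeal P}
    (hp : p i ∈ α.1) (hq : q i ∉ α.1) : α = principalIdeal (p i) := by
  refine Subtype.ext (Set.Subset.antisymm (fun w hw => ?_) fun w hw => α.2 hw hp)
  change w ≤ p i
  by_contra hwp
  have hqw : ¬ q i ≤ w := fun hle => hq (α.2 hle hw)
  have hwq : w ≤ q i := by
    by_contra hwq
    exact hwp (h.eq_left hwq hqw).le
  have hpw : ¬ p i ≤ w := fun hle => h.not_le i (hle.trans hwq)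
  exact hqw (h.symm.eq_left hwp hpw).ge

theorem eq_of_incomp (h : IncomparablePairs p q) {α β : OrderIdeal P} (hαβ : α.Incomp β) :
    ∃ i, α = principalIdeal (q i) ∨ β = principalIdeal (q i) := by
  obtain ⟨x, hx, hx'⟩ := Set.not_subset.1 hαβ.1
  obtain ⟨z, hz, hz'⟩ := Set.not_subset.1 hαβ.2
  obtain ⟨i, ⟨rfl, rfl⟩ | ⟨rfl, rfl⟩⟩ := h.exists_eq x z (fun hle => hx' (β.2 hle hz))
    fun hle => hz' (α.2 hle hx)
  · exact ⟨i, Or.inr (h.symm.eq_principalIdeal hz hx')⟩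
  · exact ⟨i, Or.inl (h.symm.eq_principalIdeal hx hz')⟩

theorem lt_left (h : IncomparablePairs p q) {i : Fin n} {x : P} (hx : q i < x) : p i < x := by
  have hxp : ¬ x ≤ p i := fun hle => h.not_ge i (hx.le.trans hle)
  refine lt_of_le_not_ge ?_ hxp
  by_contra hpx
  exact hx.ne' (h.symm.eq_left hxp hpx)

theorem left_ne (h : IncomparablePairs p q) (i k : Fin n) :
    principalIdeal (p i) ≠ principalIdeal (q k) :=
  fun he => h.ne i k (Set.Iic_injective (congrArg Subtype.val he))

theorem right_inj (h : IncomparablePairs p q) {i k : Fin n} :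
    principalIdeal (q i) = principalIdeal (q k) ↔ i = k :=
  ⟨fun he => h.right_injective (Set.Iic_injective (congrArg Subtype.val he)), fun he => he ▸ rfl⟩

theorem inter_ne (h : IncomparablePairs p q) (i k : Fin n) :
    (principalIdeal (p i)).inter (principalIdeal (q i)) ≠ principalIdeal (q k) := by
  intro he
  have hmem : ∀ x, x ≤ p i ∧ x ≤ q i ↔ x ≤ q k := fun x => Set.ext_iff.1 (congrArg Subtype.val he) x
  obtain ⟨h1, h2⟩ := (hmem (q k)).2 le_rfl
  have h1' : q k < p i := lt_of_le_of_ne h1 (h.ne i k).symm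
  have h2' : q k < q i := lt_of_le_of_ne h2 fun h3 => h.not_ge i (h3 ▸ h1)
  exact h.not_le k ((hmem (p k)).1 ⟨(h.lt_left h1').le, (h.lt_left h2').le⟩)

theorem union_ne (h : IncomparablePairs p q) (i k : Fin n) :
    (principalIdeal (p i)).union (principalIdeal (q i)) ≠ principalIdeal (q k) := by
  intro he
  have hmem : ∀ x, x ≤ p i ∨ x ≤ q i ↔ x ≤ q k := fun x => Set.ext_iff.1 (congrArg Subtype.val he) x
  have h1 := (hmem (p i)).1 (Or.inl le_rfl)
  have h2 := (hmem (q i)).1 (Or.inr le_rfl)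
  rcases (hmem (q k)).2 le_rfl with h3 | h3
  · exact h.not_ge i (h2.trans h3)
  · exact h.not_le i (h1.trans h3)

end IncomparablePairs

end IncomparablePairs

section Sufficiency

open Classical in
/-- A function on a chain of order ideals is determined by its total sum and its sums over
the members containing each element. -/
theorem eq_zero_of_chain_of_sum_eq_zero {P : Type*} [PartialOrder P]
    [Fintype (OrderIdeal P)] (δ : OrderIdeal P → ℤ)
    (hchain : ∀ α β, δ α ≠ 0 → δ β ≠ 0 → ¬ α.Incomp β) (h0 : ∑ α, δ α = 0)
    (hp : ∀ p : P, ∑ α, (if p ∈ α.1 then δ α else 0) = 0) : δ = 0 := by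
  by_contra hne
  have hmin : ∀ S : Finset (OrderIdeal P), (∀ α ∈ S, δ α ≠ 0) → S.Nonempty →
      ∃ α ∈ S, ∀ β ∈ S, α.1 ⊆ β.1 := by
    intro S hS hne
    obtain ⟨α, hα, hmin⟩ := S.exists_minimal hne
    refine ⟨α, hα, fun β hβ => ?_⟩
    have := hchain α β (hS α hα) (hS β hβ)
    rw [OrderIdeal.Incomp, not_and_or, not_not, not_not] at this
    exact this.elim id fun h => hmin hβ h
  let S : Finset (OrderIdeal P) := Finset.univ.filter fun α => δ α ≠ 0
  obtain ⟨α, hα, hαmin⟩ := hmin S (by simp [S]) (by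
    obtain ⟨α, hα⟩ := Function.ne_iff.1 hne
    exact ⟨α, by simpa [S] using hα⟩)
  have hα0 : δ α ≠ 0 := by simpa [S] using hα
  have hsplit := Finset.add_sum_erase Finset.univ δ (Finset.mem_univ α)
  by_cases hS : (S.erase α).Nonempty
  · obtain ⟨β, hβ, hβmin⟩ := hmin (S.erase α) (by simp [S]) hS
    rw [Finset.mem_erase] at hβ
    obtain ⟨x, hx, hx'⟩ := Set.not_subset.1 fun h : β.1 ⊆ α.1 =>
      hβ.1 (Subtype.ext (h.antisymm (hαmin β hβ.2)))
    have hpx := hp x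
    rw [← Finset.add_sum_erase Finset.univ _ (Finset.mem_univ α), if_neg hx', zero_add] at hpx
    rw [Finset.sum_congr rfl (g := δ)] at hpx
    · rw [hpx, add_zero, h0] at hsplit
      exact hα0 hsplit
    · intro γ hγ
      by_cases hγ0 : δ γ = 0
      · simp [hγ0]
      · rw [if_pos (hβmin γ (by simp [S, hγ0, Finset.ne_of_mem_erase hγ]) hx)]
  · rw [Finset.sum_eq_zero, add_zero, h0] at hsplit
    · exact hα0 hsplit
    · intro γ hγ
      by_contra hγ0
      exact hS ⟨γ, by simp [S, hγ0, Finset.ne_of_mem_erase hγ]⟩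

variable {P : Type*} [Finite P] [PartialOrder P] {K : Type*} [Field K] {n : ℕ} {p q : Fin n → P}

/-- The Hibi relation of the principal order ideals of `p i` and `q i`. -/
noncomputable def pairRelation (K : Type*) [Field K] (p q : Fin n → P) (i : Fin n) :
    MvPolynomial (OrderIdeal P) K :=
  hibiRelation K (principalIdeal (p i)) (principalIdeal (q i))

theorem hibiWeight_single_add_single (α β : OrderIdeal P) :
    hibiWeight (Finsupp.single α 1 + Finsupp.single β 1) = hibiExp α.1 + hibiExp β.1 := by
  simp [hibiWeight]

theorem hibiWeight_add (s t : OrderIdeal P →₀ ℕ) :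
    hibiWeight (s + t) = hibiWeight s + hibiWeight t := by
  simp [hibiWeight]

theorem IncomparablePairs.exists_reduced (h : IncomparablePairs p q) (k : ℕ)
    (s : OrderIdeal P →₀ ℕ) :
    ∃ s₀ : OrderIdeal P →₀ ℕ,
      monomial s 1 - monomial s₀ 1 ∈ Ideal.span (pairRelation K p q '' {i | (i : ℕ) < k}) ∧
      hibiWeight s₀ = hibiWeight s ∧
      (∀ i : Fin n, k ≤ i → s₀ (principalIdeal (q i)) = s (principalIdeal (q i))) ∧
      ∀ i : Fin n, (i : ℕ) < k →
        s₀ (principalIdeal (p i)) = 0 ∨ s₀ (principalIdeal (q i)) = 0 := by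
  classical
  induction hM : ∑ i, s (principalIdeal (q i)) using Nat.strong_induction_on generalizing s with
  | _ M ih =>
  by_cases hred : ∀ i : Fin n, (i : ℕ) < k →
      s (principalIdeal (p i)) = 0 ∨ s (principalIdeal (q i)) = 0
  · exact ⟨s, by simp, rfl, fun _ _ => rfl, hred⟩
  push Not at hred
  obtain ⟨i, hik, hpi, hqi⟩ := hred
  set a := principalIdeal (p i) with ha
  set y := principalIdeal (q i) with hy
  have hay : a ≠ y := h.left_ne i i
  obtain ⟨t, rfl⟩ : ∃ t, s = t + (Finsupp.single a 1 + Finsupp.single y 1) := by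
    refine ⟨s - (Finsupp.single a 1 + Finsupp.single y 1), (tsub_add_cancel_of_le ?_).symm⟩
    intro x
    simp only [Finsupp.add_apply, Finsupp.single_apply]
    split_ifs with h1 h2 h2
    · exact absurd (h1.trans h2.symm) hay
    · subst h1; omega
    · subst h2; omega
    · omega
  have hold : ∀ j, (t + (Finsupp.single a 1 + Finsupp.single y 1) : OrderIdeal P →₀ ℕ)
      (principalIdeal (q j)) =
      t (principalIdeal (q j)) + if j = i then 1 else 0 := by
    intro j
    simp [Finsupp.single_apply, ha, hy, h.left_ne i j, h.right_inj, eq_comm (a := j)]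
  have hnew : ∀ j,
      (t + (Finsupp.single (a.inter y) 1 + Finsupp.single (a.union y) 1) : OrderIdeal P →₀ ℕ)
      (principalIdeal (q j)) = t (principalIdeal (q j)) := by
    intro j
    simp [ha, hy, h.inter_ne i j, h.union_ne i j]
  obtain ⟨s₀, h1, h2, h3, h4⟩ := ih _ (by
    rw [← hM]
    refine Finset.sum_lt_sum (fun j _ => ?_) ⟨i, Finset.mem_univ i, ?_⟩
    · rw [hnew, hold]
      omega
    · rw [hnew, hold, if_pos rfl]
      omega) (t + (Finsupp.single (a.inter y) 1 + Finsupp.single (a.union y) 1)) rfl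
  refine ⟨s₀, ?_, ?_, fun j hj => ?_, h4⟩
  · rw [← sub_add_sub_cancel _
      (monomial (t + (Finsupp.single (a.inter y) 1 + Finsupp.single (a.union y) 1)) 1)]
    refine add_mem ?_ h1
    have : (monomial t 1 : MvPolynomial (OrderIdeal P) K) * pairRelation K p q i ∈
        Ideal.span (pairRelation K p q '' {i | (i : ℕ) < k}) :=
      Ideal.mul_mem_left _ _ (Ideal.subset_span ⟨i, hik, rfl⟩)
    rwa [pairRelation, hibiRelation_eq, mul_sub, monomial_mul, monomial_mul, one_mul] at this
  · rw [h2, hibiWeight_add t, hibiWeight_add t, hibiWeight_single_add_single,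
      hibiWeight_single_add_single, hibiExp_inter_add_union]
  · rw [h3 j hj, hnew, hold, if_neg, add_zero]
    rintro rfl
    omega

theorem IncomparablePairs.eq_of_reduced (h : IncomparablePairs p q) (k : ℕ)
    {s s' : OrderIdeal P →₀ ℕ} (hw : hibiWeight s = hibiWeight s')
    (hge : ∀ i : Fin n, k ≤ i → s (principalIdeal (q i)) = s' (principalIdeal (q i)))
    (hs : ∀ i : Fin n, (i : ℕ) < k →
      s (principalIdeal (p i)) = 0 ∨ s (principalIdeal (q i)) = 0)
    (hs' : ∀ i : Fin n, (i : ℕ) < k →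
      s' (principalIdeal (p i)) = 0 ∨ s' (principalIdeal (q i)) = 0) : s = s' := by
  classical
  have := Fintype.ofFinite (OrderIdeal P)
  let δ : OrderIdeal P → ℤ := fun α => (s α : ℤ) - s' α
  have hsum : ∀ x, ∑ α : OrderIdeal P, δ α * (hibiExp α.1 x : ℤ) = 0 := by
    intro x
    have := DFunLike.congr_fun hw x
    rw [hibiWeight_apply, hibiWeight_apply] at this
    simp only [δ, sub_mul, Finset.sum_sub_distrib]
    exact_mod_cast sub_eq_zero.2 (congrArg (Nat.cast : ℕ → ℤ) this)
  have h0 : ∑ α, δ α = 0 := by simpa [hibiExp_none] using hsum none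
  have hp : ∀ x : P, ∑ α : OrderIdeal P, (if x ∈ α.1 then δ α else 0) = 0 := by
    intro x
    simpa [hibiExp_some] using hsum (some x)
  have hpq : ∀ i, δ (principalIdeal (p i)) = δ (principalIdeal (q i)) := by
    intro i
    have hsub : ∑ α : OrderIdeal P,
        ((if p i ∈ α.1 then δ α else 0) - if q i ∈ α.1 then δ α else 0) = 0 := by
      rw [Finset.sum_sub_distrib, hp, hp, sub_zero]
    rw [Finset.sum_eq_add (principalIdeal (p i)) (principalIdeal (q i)) (h.left_ne i i)] at hsub
    · have h1 : p i ∈ (principalIdeal (p i)).1 := le_rfl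
      have h2 : q i ∉ (principalIdeal (p i)).1 := h.not_ge i
      have h3 : p i ∉ (principalIdeal (q i)).1 := h.not_le i
      have h4 : q i ∈ (principalIdeal (q i)).1 := le_rfl
      rw [if_pos h1, if_neg h2, if_neg h3, if_pos h4] at hsub
      linarith
    · rintro α - ⟨hα1, hα2⟩
      by_cases h1 : p i ∈ α.1 <;> by_cases h2 : q i ∈ α.1
      · simp [h1, h2]
      · exact absurd (h.eq_principalIdeal h1 h2) hα1
      · exact absurd (h.symm.eq_principalIdeal h2 h1) hα2
      · simp [h1, h2]
    · simp
    · simp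
  have hq0 : ∀ i, δ (principalIdeal (q i)) = 0 := by
    intro i
    by_cases hi : (i : ℕ) < k
    · have := hpq i
      have := hs i hi
      have := hs' i hi
      simp only [δ] at *
      omega
    · simp only [δ, hge i (not_lt.1 hi), sub_self]
  have hδ := eq_zero_of_chain_of_sum_eq_zero δ (fun α β hα hβ hαβ => by
    obtain ⟨i, rfl | rfl⟩ := h.eq_of_incomp hαβ
    · exact hα (hq0 i)
    · exact hβ (hq0 i)) h0 hp
  ext α
  have := congrFun hδ α
  simp only [δ, Pi.zero_apply] at this
  omega

theorem IncomparablePairs.monomial_sub_monomial_mem (h : IncomparablePairs p q) (k : ℕ)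
    {s s' : OrderIdeal P →₀ ℕ} (hw : hibiWeight s = hibiWeight s')
    (hge : ∀ i : Fin n, k ≤ i → s (principalIdeal (q i)) = s' (principalIdeal (q i))) :
    monomial s 1 - monomial s' 1 ∈ Ideal.span (pairRelation K p q '' {i | (i : ℕ) < k}) := by
  obtain ⟨s₀, h1, h2, h3, h4⟩ := h.exists_reduced (K := K) k s
  obtain ⟨s₁, h1', h2', h3', h4'⟩ := h.exists_reduced (K := K) k s'
  obtain rfl : s₀ = s₁ := h.eq_of_reduced k (by rw [h2, h2', hw])
    (fun i hi => by rw [h3 i hi, h3' i hi, hge i hi]) h4 h4'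
  simpa using sub_mem h1 h1'

theorem IncomparablePairs.span_pairRelation (h : IncomparablePairs p q) :
    Ideal.span (pairRelation K p q '' {i | (i : ℕ) < n}) = hibiIdeal K P := by
  refine le_antisymm (Ideal.span_le.2 ?_) ?_
  · rintro _ ⟨i, -, rfl⟩
    exact hibiRelation_mem K _ _
  · rw [hibiIdeal_eq_ker]
    exact ker_aeval_monomial_le _ _ fun s s' hs =>
      h.monomial_sub_monomial_mem n hs fun i hi => absurd i.2 (not_lt.2 hi)

open Classical in
/-- The exponent of `x_α` under the map killing only the first `k` pair relations: the Hibi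
exponent, together with a fresh variable for each later variable indexed by some `q i`. -/
noncomputable def truncatedExp (q : Fin n → P) (k : ℕ) (α : OrderIdeal P) :
    Option P ⊕ OrderIdeal P →₀ ℕ :=
  Finsupp.sumElim (hibiExp α.1)
    (if ∃ i : Fin n, k ≤ i ∧ α = principalIdeal (q i) then Finsupp.single α 1 else 0)

theorem IncomparablePairs.span_pairRelation_eq_ker (h : IncomparablePairs p q) (k : ℕ) :
    Ideal.span (pairRelation K p q '' {i | (i : ℕ) < k}) =
      RingHom.ker (aeval (fun α => monomial (truncatedExp q k α) (1 : K)) :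
        MvPolynomial (OrderIdeal P) K →ₐ[K] MvPolynomial (Option P ⊕ OrderIdeal P) K) := by
  classical
  have := Fintype.ofFinite (OrderIdeal P)
  refine le_antisymm (Ideal.span_le.2 ?_) ?_
  · rintro _ ⟨j, hj, rfl⟩
    have hj : (j : ℕ) < k := hj
    rw [SetLike.mem_coe, RingHom.mem_ker, pairRelation, hibiRelation_eq, map_sub,
      aeval_monomial_monomial, aeval_monomial_monomial, sub_eq_zero]
    congr 2
    simp only [map_add, Finsupp.linearCombination_single, one_smul]
    have h1 : ¬ ∃ i : Fin n, k ≤ i ∧ principalIdeal (p j) = principalIdeal (q i) := by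
      simp [h.left_ne]
    have h2 : ¬ ∃ i : Fin n, k ≤ i ∧ principalIdeal (q j) = principalIdeal (q i) := by
      rintro ⟨i, hi, hji⟩
      rw [h.right_inj] at hji
      subst hji
      omega
    have h3 : ¬ ∃ i : Fin n, k ≤ i ∧ (principalIdeal (p j)).inter (principalIdeal (q j)) =
        principalIdeal (q i) := by
      simp [h.inter_ne]
    have h4 : ¬ ∃ i : Fin n, k ≤ i ∧ (principalIdeal (p j)).union (principalIdeal (q j)) =
        principalIdeal (q i) := by
      simp [h.union_ne]
    rw [truncatedExp, truncatedExp, truncatedExp, truncatedExp, if_neg h1, if_neg h2, if_neg h3,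
      if_neg h4]
    refine Finsupp.ext ?_
    rintro (x | x)
    · exact (DFunLike.congr_fun (hibiExp_inter_add_union (principalIdeal (p j))
        (principalIdeal (q j))) x).symm
    · rfl
  · refine ker_aeval_monomial_le _ _ fun s s' hs => ?_
    have happ : ∀ (s : OrderIdeal P →₀ ℕ) x,
        Finsupp.linearCombination ℕ (truncatedExp q k) s x = ∑ α, s α * truncatedExp q k α x := by
      intro s x
      rw [Finsupp.linearCombination_apply, Finsupp.sum_fintype _ _ (by simp)]
      simp [Finsupp.finsetSum_apply]
    refine h.monomial_sub_monomial_mem k ?_ fun i hi => ?_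
    · ext x
      have := DFunLike.congr_fun hs (Sum.inl x)
      rw [happ, happ] at this
      simpa [hibiWeight_apply, truncatedExp] using this
    · have := DFunLike.congr_fun hs (Sum.inr (principalIdeal (q i)))
      rw [happ, happ] at this
      have hval : ∀ α : OrderIdeal P, truncatedExp q k α (Sum.inr (principalIdeal (q i))) =
          if α = principalIdeal (q i) then 1 else 0 := by
        intro α
        rw [truncatedExp, Finsupp.sumElim_inr]
        by_cases hα : α = principalIdeal (q i)
        · subst hα
          rw [if_pos ⟨i, hi, rfl⟩]
          simp
        · rw [if_neg hα]
          split_ifs <;> simp [hα]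
      simpa [hval] using this

theorem IncomparablePairs.mem_span_of_pairRelation_mul_mem (h : IncomparablePairs p q) (k : Fin n)
    (x : MvPolynomial (OrderIdeal P) K)
    (hx : pairRelation K p q k * x ∈ Ideal.span (pairRelation K p q '' {i | (i : ℕ) < k})) :
    x ∈ Ideal.span (pairRelation K p q '' {i | (i : ℕ) < k}) := by
  classical
  rw [h.span_pairRelation_eq_ker, RingHom.mem_ker] at hx ⊢
  rw [map_mul] at hx
  refine (mul_eq_zero.1 hx).resolve_left fun h0 => ?_
  rw [pairRelation, hibiRelation_eq, map_sub, aeval_monomial_monomial, aeval_monomial_monomial,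
    sub_eq_zero] at h0
  have h1 := monomial_left_injective one_ne_zero h0
  have h2 := DFunLike.congr_fun h1 (Sum.inr (principalIdeal (q k)))
  have hk : ∃ i : Fin n, k ≤ i ∧ principalIdeal (q k) = principalIdeal (q i) :=
    ⟨k, le_rfl, rfl⟩
  simp [truncatedExp, h.left_ne, h.inter_ne, h.union_ne, hk] at h2

theorem IncomparablePairs.exists_regular (h : IncomparablePairs p q) :
    ∃ rs : List (MvPolynomial (OrderIdeal P) K),
      RingTheory.Sequence.IsRegular (MvPolynomial (OrderIdeal P) K) rs ∧
        Ideal.span {f | f ∈ rs} = hibiIdeal K P := by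
  let rs := List.ofFn (pairRelation K p q)
  have hlen : rs.length = n := List.length_ofFn
  have hget : ∀ i : Fin n, rs.getD i 0 = pairRelation K p q i := by
    intro i
    rw [List.getD_eq_getElem _ _ (by rw [hlen]; exact i.2), List.getElem_ofFn]
  have himg : ∀ k ≤ n, (fun j => rs.getD j 0) '' Set.Iio k =
      pairRelation K p q '' {i | (i : ℕ) < k} := by
    intro k hk
    ext x
    constructor
    · rintro ⟨j, hj, rfl⟩
      exact ⟨⟨j, lt_of_lt_of_le hj hk⟩, hj, (hget _).symm⟩
    · rintro ⟨j, hj, rfl⟩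
      exact ⟨j, hj, hget j⟩
  have hspan : Ideal.ofList rs = hibiIdeal K P := by
    rw [← h.span_pairRelation, ← himg n le_rfl, ← ideal_ofList_take_eq_span rs n hlen.ge,
      List.take_of_length_le hlen.le]
  refine ⟨rs, ⟨(isWeaklyRegular_self_iff rs).2 fun i hi x hx => ?_, ?_⟩, hspan⟩
  · rw [hlen] at hi
    rw [himg i hi.le] at hx ⊢
    rw [hget ⟨i, hi⟩] at hx
    exact h.mem_span_of_pairRelation_mul_mem ⟨i, hi⟩ x hx
  · rw [hspan, Ideal.smul_eq_mul, Ideal.mul_top]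
    intro htop
    have h1 : (1 : MvPolynomial (OrderIdeal P) K) ∈ hibiIdeal K P := htop ▸ Submodule.mem_top
    rw [hibiIdeal, RingHom.mem_ker, map_one] at h1
    exact one_ne_zero h1

end Sufficiency

section PairLevels

variable {P : Type*} [PartialOrder P]

theorem lt_of_lt_of_unique_incomp
    (hu : ∀ p q r : P, ¬ p ≤ q → ¬ q ≤ p → ¬ p ≤ r → ¬ r ≤ p → q = r) {a b x : P}
    (hab : ¬ a ≤ b) (hba : ¬ b ≤ a) (h : a < x) : b < x := by
  have hxb : ¬ x ≤ b := fun hle => hab (h.le.trans hle)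
  refine lt_of_le_not_ge ?_ hxb
  by_contra hbx
  exact h.ne (hu b a x hba hab hbx hxb)

theorem lt_of_gt_of_unique_incomp
    (hu : ∀ p q r : P, ¬ p ≤ q → ¬ q ≤ p → ¬ p ≤ r → ¬ r ≤ p → q = r) {a b x : P}
    (hab : ¬ a ≤ b) (hba : ¬ b ≤ a) (h : x < a) : x < b := by
  have hbx : ¬ b ≤ x := fun hle => hba (hle.trans h.le)
  refine lt_of_le_not_ge ?_ hbx
  by_contra hxb
  exact h.ne (hu b a x hba hab hbx hxb).symm

/-- If incomparability is a partial matching on a finite poset, the elements incomparable to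
something are stacked in levels of two. -/
theorem exists_equiv_levels [Finite P]
    (hu : ∀ p q r : P, ¬ p ≤ q → ¬ q ≤ p → ¬ p ≤ r → ¬ r ≤ p → q = r) :
    ∃ n : ℕ, ∃ f : {p : P // ¬ ∀ q : P, p ≤ q ∨ q ≤ p} ≃ Fin n × Fin 2,
      ∀ p q : {p : P // ¬ ∀ q : P, p ≤ q ∨ q ≤ p}, (p : P) < (q : P) ↔ (f p).1 < (f q).1 := by
  classical
  have hex : ∀ a : {p : P // ¬ ∀ q : P, p ≤ q ∨ q ≤ p},
      ∃ b : {p : P // ¬ ∀ q : P, p ≤ q ∨ q ≤ p}, ¬ (a : P) ≤ b ∧ ¬ (b : P) ≤ a := by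
    rintro ⟨a, ha⟩
    have ha' := ha
    push Not at ha'
    obtain ⟨b, hab, hba⟩ := ha'
    exact ⟨⟨b, fun h => (h a).elim hba hab⟩, hab, hba⟩
  choose m hm hm' using hex
  let S := {a : {p : P // ¬ ∀ q : P, p ≤ q ∨ q ≤ p} //
    toLinearExtension (a : P) < toLinearExtension (m a : P)}
  have hm_eq : ∀ a b : {p : P // ¬ ∀ q : P, p ≤ q ∨ q ≤ p},
      ¬ (a : P) ≤ b → ¬ (b : P) ≤ a → m a = b := fun a b hab hba =>
    Subtype.ext (hu a (m a) b (hm a) (hm' a) hab hba)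
  have hmm : ∀ a, m (m a) = a := fun a => hm_eq _ _ (hm' a) (hm a)
  have htotal : ∀ a b : S, a ≤ b ∨ b ≤ a := by
    intro a b
    by_contra! hab
    have h1 := a.2
    have h2 := b.2
    rw [hm_eq a.1 b.1 hab.1 hab.2] at h1
    rw [hm_eq b.1 a.1 hab.2 hab.1] at h2
    exact lt_asymm h1 h2
  have : Finite S := inferInstance
  have := Fintype.ofFinite S
  let : LinearOrder S :=
    { (inferInstance : PartialOrder S) with
      le_total := htotal
      toDecidableLE := Classical.decRel _ }
  let e := monoEquivOfFin S rfl
  let g : Fin (Fintype.card S) × Fin 2 → {p : P // ¬ ∀ q : P, p ≤ q ∨ q ≤ p} :=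
    fun x => if x.2 = 0 then (e x.1).1 else m (e x.1).1
  have hlt : ∀ x y, x.1 < y.1 → (g x : P) < g y := by
    rintro ⟨i, b⟩ ⟨j, c⟩ hij
    have h1 : ((e i).1 : P) < (e j).1 := e.lt_iff_lt.2 hij
    have h2 := lt_of_lt_of_unique_incomp hu (hm (e i).1) (hm' (e i).1) h1
    simp only [g]
    split_ifs
    · exact h1
    · exact lt_of_gt_of_unique_incomp hu (hm (e j).1) (hm' (e j).1) h1
    · exact h2
    · exact lt_of_gt_of_unique_incomp hu (hm (e j).1) (hm' (e j).1) h2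
  have hlevel : ∀ x y, x.1 = y.1 → x = y ∨ (¬ (g x : P) ≤ g y ∧ ¬ (g y : P) ≤ g x) := by
    rintro ⟨i, b⟩ ⟨j, c⟩ rfl
    have h1 := hm (e i).1
    have h2 := hm' (e i).1
    fin_cases b <;> fin_cases c <;> simp [g, h1, h2]
  have hinj : Function.Injective g := by
    intro x y hxy
    rcases lt_trichotomy x.1 y.1 with h | h | h
    · exact absurd (hxy ▸ hlt x y h) (lt_irrefl _)
    · exact (hlevel x y h).resolve_right fun h' => h'.1 (hxy ▸ le_rfl)
    · exact absurd (hxy ▸ hlt y x h) (lt_irrefl _)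
  have hsurj : Function.Surjective g := by
    intro a
    have hne : toLinearExtension (a : P) ≠ toLinearExtension (m a : P) :=
      fun h => hm a (le_of_eq h)
    rcases hne.lt_or_gt with h | h
    · exact ⟨(e.symm ⟨a, h⟩, 0), by simp [g]⟩
    · refine ⟨(e.symm ⟨m a, by rwa [hmm]⟩, 1), by simp [g, hmm]⟩
  refine ⟨Fintype.card S, (Equiv.ofBijective g ⟨hinj, hsurj⟩).symm, fun a b => ?_⟩
  obtain ⟨x, rfl⟩ := (Equiv.ofBijective g ⟨hinj, hsurj⟩).surjective a
  obtain ⟨y, rfl⟩ := (Equiv.ofBijective g ⟨hinj, hsurj⟩).surjective b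
  rw [Equiv.symm_apply_apply, Equiv.symm_apply_apply]
  refine ⟨fun h => ?_, hlt x y⟩
  change (g x : P) < g y at h
  by_contra hxy
  rcases (not_lt.1 hxy).lt_or_eq with h' | h'
  · exact lt_asymm h (hlt y x h')
  · rcases hlevel x y h'.symm with rfl | h''
    · exact lt_irrefl _ h
    · exact h''.1 h.le

theorem incomparablePairs_of_equiv {n : ℕ}
    (f : {p : P // ¬ ∀ q : P, p ≤ q ∨ q ≤ p} ≃ Fin n × Fin 2)
    (hf : ∀ p q : {p : P // ¬ ∀ q : P, p ≤ q ∨ q ≤ p}, (p : P) < (q : P) ↔ (f p).1 < (f q).1) :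
    IncomparablePairs (fun i => (f.symm (i, 0) : P)) (fun i => (f.symm (i, 1) : P)) where
  not_le i h := by
    rcases h.lt_or_eq with h | h
    · simp [hf] at h
    · simpa using Subtype.ext h
  not_ge i h := by
    rcases h.lt_or_eq with h | h
    · simp [hf] at h
    · simpa using Subtype.ext h
  exists_eq a b hab hba := by
    obtain ⟨⟨i, x⟩, hx⟩ := f.symm.surjective ⟨a, fun h => (h b).elim hab hba⟩
    obtain ⟨⟨j, y⟩, hy⟩ := f.symm.surjective ⟨b, fun h => (h a).elim hba hab⟩
    obtain rfl : a = f.symm (i, x) := by rw [hx]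
    obtain rfl : b = f.symm (j, y) := by rw [hy]
    have h1 := fun h => hab ((hf (f.symm (i, x)) (f.symm (j, y))).2 h).le
    have h2 := fun h => hba ((hf (f.symm (j, y)) (f.symm (i, x))).2 h).le
    rw [Equiv.apply_symm_apply, Equiv.apply_symm_apply] at h1 h2
    obtain rfl : i = j := le_antisymm (not_lt.1 h2) (not_lt.1 h1)
    refine ⟨i, ?_⟩
    fin_cases x <;> fin_cases y <;> simp at hab ⊢
  ne i j h := by simpa using Subtype.ext h
  left_injective i j h := by simpa using Subtype.ext h
  right_injective i j h := by simpa using Subtype.ext h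

theorem incomparablePairs_of_chain (h : ∀ a b : P, a ≤ b ∨ b ≤ a) :
    IncomparablePairs (Fin.elim0 : Fin 0 → P) Fin.elim0 where
  not_le i := i.elim0
  not_ge i := i.elim0
  exists_eq a b hab hba := absurd (h a b) (not_or.2 ⟨hab, hba⟩)
  ne i := i.elim0
  left_injective i := i.elim0
  right_injective i := i.elim0

end PairLevels

theorem stmt13 (K : Type*) [Field K] (P : Type*) [Finite P] [PartialOrder P] :
    (∃ rs : List (MvPolynomial {α : Set P // IsLowerSet α} K),
        RingTheory.Sequence.IsRegular (MvPolynomial {α : Set P // IsLowerSet α} K) rs ∧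
        Ideal.span {f | f ∈ rs} = hibiIdeal K P) ↔
      ((∀ a b : P, a ≤ b ∨ b ≤ a) ∨
        ∃ n : ℕ, 1 ≤ n ∧
          ∃ f : {p : P // ¬ ∀ q : P, p ≤ q ∨ q ≤ p} ≃ Fin n × Fin 2,
            ∀ p q : {p : P // ¬ ∀ q : P, p ≤ q ∨ q ≤ p},
              (p : P) < (q : P) ↔ (f p).1 < (f q).1) := by
  constructor
  · rintro ⟨rs, hrs, hI⟩
    by_cases hchain : ∀ a b : P, a ≤ b ∨ b ≤ a
    · exact Or.inl hchain
    obtain ⟨n, f, hf⟩ := exists_equiv_levels fun _ _ _ hpq hqp hpr hrp =>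
      subsingleton_incomparable_of_regular hrs.toIsWeaklyRegular hI hpq hqp hpr hrp
    push Not at hchain
    obtain ⟨a, b, hab, hba⟩ := hchain
    exact Or.inr ⟨n, Fin.pos (f ⟨a, fun h => (h b).elim hab hba⟩).1, f, hf⟩
  · rintro (hchain | ⟨n, -, f, hf⟩)
    · exact (incomparablePairs_of_chain hchain).exists_regular
    · exact (incomparablePairs_of_equiv f hf).exists_regular
end
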